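/- arXiv:2404.03104 — 7 statements merged into one kernel-verified Lean document; each statement's English description precedes it below -/
import Mathlib

section
/- Let F be a finitely generated free group and let R be a subset of F. If the quotient F/⟪R⟫ is finitely presented, then there exists a finite subset R₀ ⊆ R such that the normal closure ⟪R₀⟫ of R₀ in F equals the normal closure ⟪R⟫ of R in F (and hence F/⟪R⟫ = F/⟪R₀⟫). -/
/-- A group is *finitely presented* if it is isomorphic to the quotient of a
finitely generated free group by the normal closure of a finite set of relators. -/
def FinitelyPresented (G : Type*) [Group G] : Prop :=
  ∃ (n : ℕ) (R : Set (FreeGroup (Fin n))), R.Finite ∧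
    Nonempty ((FreeGroup (Fin n) ⧸ Subgroup.normalClosure R) ≃* G)

namespace Subgroup

variable {G : Type*} [Group G]

theorem exists_finite_subset_mem_normalClosure {R : Set G} {x : G}
    (hx : x ∈ normalClosure R) :
    ∃ R₀ ⊆ R, R₀.Finite ∧ x ∈ normalClosure R₀ := by
  unfold normalClosure at hx
  induction hx using closure_induction with
  | mem x hx =>
    obtain ⟨r, hr, hrx⟩ := Group.mem_conjugatesOfSet_iff.1 hx
    exact ⟨{r}, Set.singleton_subset_iff.2 hr, Set.finite_singleton r,
      conjugatesOfSet_subset_normalClosure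
        (Group.mem_conjugatesOfSet_iff.2 ⟨r, rfl, hrx⟩)⟩
  | one => exact ⟨∅, Set.empty_subset _, Set.finite_empty, one_mem _⟩
  | mul x y _ _ hx hy =>
    obtain ⟨A, hAR, hA, hxA⟩ := hx
    obtain ⟨B, hBR, hB, hyB⟩ := hy
    exact ⟨A ∪ B, Set.union_subset hAR hBR, hA.union hB,
      mul_mem (normalClosure_mono Set.subset_union_left hxA)
        (normalClosure_mono Set.subset_union_right hyB)⟩
  | inv x _ hx =>
    obtain ⟨A, hAR, hA, hxA⟩ := hx
    exact ⟨A, hAR, hA, inv_mem hxA⟩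

theorem IsFinitelyNormallyGenerated.exists_finite_subset_normalClosure_eq {R : Set G}
    (hR : (normalClosure R).IsFinitelyNormallyGenerated) :
    ∃ R₀ ⊆ R, R₀.Finite ∧ normalClosure R₀ = normalClosure R := by
  obtain ⟨T, hT, h⟩ := hR
  have hmem (t : T) : ∃ R₀ ⊆ R, R₀.Finite ∧ (t : G) ∈ normalClosure R₀ :=
    exists_finite_subset_mem_normalClosure (h ▸ subset_normalClosure t.2)
  choose A hAR hA htA using hmem
  have := hT.to_subtype
  refine ⟨⋃ t, A t, Set.iUnion_subset hAR, Set.finite_iUnion hA,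
    le_antisymm (normalClosure_mono (Set.iUnion_subset hAR)) ?_⟩
  rw [← h]
  exact normalClosure_le_normal fun t ht =>
    normalClosure_mono (Set.subset_iUnion A ⟨t, ht⟩) (htA ⟨t, ht⟩)

end Subgroup

open Subgroup in
theorem FreeGroup.isFinitelyNormallyGenerated_ker {α β G : Type*} [Finite α] [Group G]
    {π : FreeGroup α →* G} (hπ : Function.Surjective π)
    {φ : FreeGroup β →* G} (hφ : Function.Surjective φ)
    (hker : φ.ker.IsFinitelyNormallyGenerated) : π.ker.IsFinitelyNormallyGenerated := by
  obtain ⟨S, hS, hker⟩ := hker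
  choose s hs using fun b => hπ (φ (of b))
  choose t ht using fun a => hφ (π (of a))
  have hσ : π.comp (lift s) = φ := by ext b; simp [hs]
  have hτ : φ.comp (lift t) = π := by ext a; simp [ht]
  have hσ' (x) : π (lift s x) = φ x := DFunLike.congr_fun hσ x
  have hτ' (x) : φ (lift t x) = π x := DFunLike.congr_fun hτ x
  set T : Set (FreeGroup α) :=
    lift s '' S ∪ Set.range fun a => (of a)⁻¹ * lift s (lift t (of a))
  refine ⟨T, (hS.image _).union (Set.finite_range _), le_antisymm ?_ ?_⟩
  · refine normalClosure_le_normal ?_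
    rintro _ (⟨x, hx, rfl⟩ | ⟨a, rfl⟩)
    · have : x ∈ φ.ker := hker ▸ subset_normalClosure hx
      simpa [MonoidHom.mem_ker, hσ'] using this
    · change π ((of a)⁻¹ * lift s (lift t (of a))) = 1
      rw [_root_.map_mul, _root_.map_inv, hσ', hτ', inv_mul_cancel]
  · have hq : (QuotientGroup.mk' (normalClosure T)).comp ((lift s).comp (lift t)) =
        QuotientGroup.mk' (normalClosure T) := by
      ext a
      have ha : (of a)⁻¹ * lift s (lift t (of a)) ∈ normalClosure T :=
        subset_normalClosure (Or.inr ⟨a, rfl⟩)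
      exact (QuotientGroup.eq.2 ha).symm
    have hle : φ.ker ≤ (normalClosure T).comap (lift s) := by
      rw [← hker]
      exact normalClosure_le_normal fun x hx =>
        subset_normalClosure (Or.inl ⟨x, hx, rfl⟩)
    intro w hw
    have hw' : lift s (lift t w) ∈ normalClosure T :=
      hle (by rwa [MonoidHom.mem_ker, hτ'])
    have hqw := DFunLike.congr_fun hq w
    rw [← QuotientGroup.eq_one_iff] at hw' ⊢
    exact hqw.symm.trans hw'

/-- If `F` is a finitely generated free group, `R ⊆ F`, and `F/⟪R⟫` is finitely
presented, then some finite subset `R₀ ⊆ R` has the same normal closure as `R`. -/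
theorem stmt_0 {α : Type*} [Finite α] (R : Set (FreeGroup α))
    (h : FinitelyPresented (FreeGroup α ⧸ Subgroup.normalClosure R)) :
    ∃ R₀ : Set (FreeGroup α), R₀ ⊆ R ∧ R₀.Finite ∧
      Subgroup.normalClosure R₀ = Subgroup.normalClosure R := by
  obtain ⟨n, S, hS, ⟨e⟩⟩ := h
  have hker := FreeGroup.isFinitelyNormallyGenerated_ker
    (QuotientGroup.mk'_surjective (Subgroup.normalClosure R))
    (φ := e.toMonoidHom.comp (QuotientGroup.mk' (Subgroup.normalClosure S)))
    (e.surjective.comp (QuotientGroup.mk'_surjective _))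
    ⟨S, hS, by ext x; simp⟩
  rw [QuotientGroup.ker_mk'] at hker
  exact hker.exists_finite_subset_normalClosure_eq
end

section
/- For every n ≥ 1, every partial order ≤ on a finite set V of cardinality n, and every coloring c : V → {0,1}, there exists a realization of (V, ≤, c) in the free group F_{2n} of rank 2n. -/
/-- The kernel of any surjection from a finitely generated free group onto `G` is finitely normally
generated as soon as this holds for one such surjection. -/
theorem Subgroup.IsFinitelyNormallyGenerated.ker_of_ker {α β G : Type*} [Finite α] [Group G]
    {f : FreeGroup β →* G} {g : FreeGroup α →* G} (hf : Function.Surjective f)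
    (hg : Function.Surjective g) (h : f.ker.IsFinitelyNormallyGenerated) :
    g.ker.IsFinitelyNormallyGenerated := by
  obtain ⟨R, hR, hRf⟩ := h
  let σ : FreeGroup α →* FreeGroup β :=
    FreeGroup.lift fun a => Function.surjInv hf (g (FreeGroup.of a))
  let τ : FreeGroup β →* FreeGroup α :=
    FreeGroup.lift fun b => Function.surjInv hg (f (FreeGroup.of b))
  have hσ : f.comp σ = g := by
    ext a; simp [σ, Function.surjInv_eq hf]
  have hτ : g.comp τ = f := by
    ext b; simp [τ, Function.surjInv_eq hg]
  have hστ (x) : g (τ (σ x)) = g x := by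
    rw [← MonoidHom.comp_apply, hτ, ← MonoidHom.comp_apply, hσ]
  set T : Set (FreeGroup α) :=
    τ '' R ∪ Set.range fun a => (FreeGroup.of a)⁻¹ * τ (σ (FreeGroup.of a)) with hT
  refine ⟨T, (hR.image _).union (Set.finite_range _), le_antisymm ?_ fun y hy => ?_⟩
  · apply Subgroup.normalClosure_le_normal
    rintro _ (⟨r, hr, rfl⟩ | ⟨a, rfl⟩)
    · have : r ∈ f.ker := hRf ▸ Subgroup.subset_normalClosure hr
      simpa [← hτ] using this
    · simp [MonoidHom.mem_ker, hστ]
  · have hmod : (QuotientGroup.mk' (Subgroup.normalClosure T)).comp (τ.comp σ) =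
        QuotientGroup.mk' (Subgroup.normalClosure T) := by
      ext a
      exact (QuotientGroup.eq.2 (Subgroup.subset_normalClosure
        (show (FreeGroup.of a)⁻¹ * τ (σ (FreeGroup.of a)) ∈ T from Or.inr ⟨a, rfl⟩))).symm
    have hker : f.ker ≤ (Subgroup.normalClosure T).comap τ := by
      rw [← hRf]
      exact Subgroup.normalClosure_le_normal fun r hr =>
        Subgroup.subset_normalClosure (Or.inl ⟨r, hr, rfl⟩)
    have hy' : τ (σ y) ∈ Subgroup.normalClosure T := by
      apply hker
      rw [MonoidHom.mem_ker, ← MonoidHom.comp_apply, hσ]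
      exact hy
    have := DFunLike.congr_fun hmod y
    rw [← QuotientGroup.eq_one_iff] at hy' ⊢
    exact this.symm.trans hy'

theorem finitelyPresented_quotient_iff {n : ℕ} (N : Subgroup (FreeGroup (Fin n))) [N.Normal] :
    FinitelyPresented (FreeGroup (Fin n) ⧸ N) ↔ N.IsFinitelyNormallyGenerated := by
  constructor
  · rintro ⟨m, R, hR, ⟨e⟩⟩
    rw [← QuotientGroup.ker_mk' N]
    refine .ker_of_ker
      (f := e.toMonoidHom.comp (QuotientGroup.mk' (Subgroup.normalClosure R)))
      (e.surjective.comp (QuotientGroup.mk'_surjective _)) (QuotientGroup.mk'_surjective N)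
      ⟨R, hR, ?_⟩
    exact (QuotientGroup.ker_mk' _).symm.trans (MonoidHom.ker_mulEquiv_comp _ e).symm
  · rintro ⟨R, hR, h⟩
    exact ⟨n, R, hR, ⟨QuotientGroup.quotientMulEquivOfEq h⟩⟩

/-- The action of the free group of rank two on `ℤ` by the unit translation and by the
transposition of `0` and `k + 1`. -/
def shiftSwapHom (k : ℕ) : FreeGroup Bool →* Equiv.Perm ℤ :=
  FreeGroup.lift fun b => if b then Equiv.addRight 1 else Equiv.swap 0 (k + 1 : ℤ)

open scoped commutatorElement in
/-- The commutator of the second generator with its conjugate by the `(i + 1)`-st power of the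
first one. -/
def conjCommutator (i : ℕ) : FreeGroup Bool :=
  ⁅FreeGroup.of false,
    FreeGroup.of true ^ (i + 1) * FreeGroup.of false * (FreeGroup.of true ^ (i + 1))⁻¹⁆

theorem shiftSwapHom_conj (k i : ℕ) :
    shiftSwapHom k
      (FreeGroup.of true ^ (i + 1) * FreeGroup.of false * (FreeGroup.of true ^ (i + 1))⁻¹) =
      Equiv.swap (i + 1 : ℤ) (k + 1 + (i + 1)) := by
  have hpow (m : ℕ) (x : ℤ) : (Equiv.addRight (1 : ℤ) ^ m) x = x + m := by
    induction m with
    | zero => simp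
    | succ m ih => rw [pow_succ', Equiv.Perm.mul_apply, ih]; simp [add_assoc]
  have h := Equiv.swap_apply_apply (Equiv.addRight (1 : ℤ) ^ (i + 1)) 0 (k + 1 : ℤ)
  rw [hpow, hpow] at h
  simp only [shiftSwapHom, map_mul, map_pow, map_inv, FreeGroup.lift_apply_of, if_true,
    Bool.false_eq_true, if_false]
  rw [← h]
  simp

theorem shiftSwapHom_conjCommutator_eq_one_iff (k i : ℕ) :
    shiftSwapHom k (conjCommutator i) = 1 ↔ i ≠ k := by
  rw [conjCommutator, map_commutatorElement, commutatorElement_eq_one_iff_mul_comm,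
    shiftSwapHom_conj]
  simp only [shiftSwapHom, FreeGroup.lift_apply_of, Bool.false_eq_true, if_false]
  constructor
  · rintro h rfl
    have := DFunLike.congr_fun h 0
    simp only [Equiv.Perm.mul_apply, Equiv.swap_apply_def] at this
    grind
  · intro hik
    ext x
    simp only [Equiv.Perm.mul_apply, Equiv.swap_apply_def]
    grind

/-- The elements of the free group of rank two that die under all but finitely many of the
homomorphisms `shiftSwapHom k`. -/
def eventualKernel : Subgroup (FreeGroup Bool) where
  carrier := {x | ∀ᶠ k in Filter.atTop, shiftSwapHom k x = 1}
  mul_mem' ha hb := by filter_upwards [ha, hb] with k h₁ h₂; simp [h₁, h₂]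
  one_mem' := by simp
  inv_mem' ha := by filter_upwards [ha] with k h; simp [h]

theorem mem_eventualKernel {x : FreeGroup Bool} :
    x ∈ eventualKernel ↔ ∀ᶠ k in Filter.atTop, shiftSwapHom k x = 1 := Iff.rfl

instance normal_eventualKernel : eventualKernel.Normal where
  conj_mem x hx g := by
    rw [mem_eventualKernel] at hx ⊢
    filter_upwards [hx] with k h
    simp [h]

theorem conjCommutator_mem_eventualKernel (i : ℕ) : conjCommutator i ∈ eventualKernel := by
  rw [mem_eventualKernel]
  filter_upwards [Filter.eventually_gt_atTop i] with k hk
  exact (shiftSwapHom_conjCommutator_eq_one_iff k i).2 hk.ne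

theorem conjCommutator_ne_one (i : ℕ) : conjCommutator i ≠ 1 := fun h =>
  (shiftSwapHom_conjCommutator_eq_one_iff i i).1 (by rw [h, map_one]) rfl

theorem not_isFinitelyNormallyGenerated_eventualKernel :
    ¬ eventualKernel.IsFinitelyNormallyGenerated := by
  rintro ⟨S, hS, h⟩
  have hev : ∀ᶠ k in Filter.atTop, ∀ s ∈ S, shiftSwapHom k s = 1 :=
    (Filter.eventually_all_finite hS).2 fun s hs =>
      mem_eventualKernel.1 (h ▸ Subgroup.subset_normalClosure hs)
  obtain ⟨k, hk⟩ := hev.exists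
  have hle : eventualKernel ≤ (shiftSwapHom k).ker :=
    h ▸ Subgroup.normalClosure_le_normal hk
  exact (shiftSwapHom_conjCommutator_eq_one_iff k k).1
    (hle (conjCommutator_mem_eventualKernel k)) rfl

section Realization

variable {V α : Type*} (e : V × Bool ≃ α)

/-- The inclusion of the free factor of rank two indexed by `v`. -/
def factorInclusion (v : V) : FreeGroup Bool →* FreeGroup α :=
  FreeGroup.map fun b => e (v, b)

open Classical in
/-- The retraction onto the free factor of rank two indexed by `v` killing all other factors. -/
noncomputable def factorRetraction (v : V) : FreeGroup α →* FreeGroup Bool :=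
  FreeGroup.lift fun x => if (e.symm x).1 = v then FreeGroup.of (e.symm x).2 else 1

theorem factorRetraction_factorInclusion_self (v : V) (y : FreeGroup Bool) :
    factorRetraction e v (factorInclusion e v y) = y := by
  have : (factorRetraction e v).comp (factorInclusion e v) = MonoidHom.id _ := by
    ext b; simp [factorRetraction, factorInclusion]
  exact DFunLike.congr_fun this y

theorem factorRetraction_factorInclusion_of_ne {u v : V} (h : v ≠ u) (y : FreeGroup Bool) :
    factorRetraction e u (factorInclusion e v y) = 1 := by
  have : (factorRetraction e u).comp (factorInclusion e v) = 1 := by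
    ext b; simp [factorRetraction, factorInclusion, h]
  exact DFunLike.congr_fun this y

theorem factorRetraction_surjective (v : V) : Function.Surjective (factorRetraction e v) :=
  fun y => ⟨_, factorRetraction_factorInclusion_self e v y⟩

variable [PartialOrder V] (T : V → Set (FreeGroup Bool))

/-- Relators killing all free factors below `v`, and imposing the relators `T v` on the free
factor indexed by `v`. -/
def orderRelators (v : V) : Set (FreeGroup α) :=
  {x | ∃ w < v, ∃ b, factorInclusion e w (FreeGroup.of b) = x} ∪ factorInclusion e v '' T v

theorem factorInclusion_mem_of_lt {u v : V} (h : u < v) (y : FreeGroup Bool) :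
    factorInclusion e u y ∈ Subgroup.normalClosure (orderRelators e T v) := by
  have : (⊤ : Subgroup (FreeGroup Bool)) ≤
      (Subgroup.normalClosure (orderRelators e T v)).comap (factorInclusion e u) := by
    rw [← FreeGroup.closure_range_of, Subgroup.closure_le]
    rintro _ ⟨b, rfl⟩
    exact Subgroup.subset_normalClosure (Or.inl ⟨u, h, b, rfl⟩)
  exact this (Subgroup.mem_top y)

theorem normalClosure_orderRelators_le_iff (hT : ∀ v, ∃ t ∈ T v, t ≠ 1) (u v : V) :
    Subgroup.normalClosure (orderRelators e T u) ≤
      Subgroup.normalClosure (orderRelators e T v) ↔ u ≤ v := by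
  constructor
  · intro h
    by_contra huv
    have hker : Subgroup.normalClosure (orderRelators e T v) ≤ (factorRetraction e u).ker := by
      apply Subgroup.normalClosure_le_normal
      rintro _ (⟨w, hw, b, rfl⟩ | ⟨t, -, rfl⟩)
      · exact factorRetraction_factorInclusion_of_ne e (by rintro rfl; exact huv hw.le) _
      · exact factorRetraction_factorInclusion_of_ne e (fun hvu => huv hvu.ge) _
    obtain ⟨t, ht, ht1⟩ := hT u
    have := hker (h (Subgroup.subset_normalClosure (Or.inr ⟨t, ht, rfl⟩)))
    rw [MonoidHom.mem_ker, factorRetraction_factorInclusion_self] at this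
    exact ht1 this
  · intro h
    rcases h.eq_or_lt with rfl | hlt
    · exact le_rfl
    apply Subgroup.normalClosure_le_normal
    rintro _ (⟨w, hw, b, rfl⟩ | ⟨t, -, rfl⟩)
    · exact factorInclusion_mem_of_lt e T (hw.trans hlt) _
    · exact factorInclusion_mem_of_lt e T hlt _

theorem map_normalClosure_orderRelators (v : V) :
    (Subgroup.normalClosure (orderRelators e T v)).map (factorRetraction e v) =
      Subgroup.normalClosure (T v) := by
  rw [Subgroup.map_normalClosure _ _ (factorRetraction_surjective e v)]
  apply le_antisymm <;> apply Subgroup.normalClosure_le_normal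
  · rintro _ ⟨_, ⟨w, hw, b, rfl⟩ | ⟨t, ht, rfl⟩, rfl⟩
    · rw [factorRetraction_factorInclusion_of_ne e hw.ne]
      exact one_mem _
    · rw [factorRetraction_factorInclusion_self]
      exact Subgroup.subset_normalClosure ht
  · intro t ht
    exact Subgroup.subset_normalClosure
      ⟨_, Or.inr ⟨t, ht, rfl⟩, factorRetraction_factorInclusion_self e v t⟩

theorem finite_orderRelators [Finite V] {v : V} (h : (T v).Finite) :
    (orderRelators e T v).Finite := by
  refine Set.Finite.union (Set.Finite.subset (Set.finite_range fun p : V × Bool =>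
    factorInclusion e p.1 (FreeGroup.of p.2)) ?_) (h.image _)
  rintro _ ⟨w, -, b, rfl⟩
  exact ⟨(w, b), rfl⟩

end Realization

/-- Any finite colored partial order of order `n ≥ 1` admits a realization in the
free group of rank `2n`. -/
theorem stmt_1 (n : ℕ) (hn : 1 ≤ n) (V : Type) [Fintype V] [PartialOrder V]
    (hcard : Fintype.card V = n) (c : V → Fin 2) :
    ∃ N : V → Subgroup (FreeGroup (Fin (2 * n))),
      Function.Injective N ∧
      (∀ u v : V, u ≤ v ↔ N u ≤ N v) ∧
      (∀ v : V, ∃ h : (N v).Normal,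
        ((letI := h; FinitelyPresented (FreeGroup (Fin (2 * n)) ⧸ N v)) ↔ c v = 0)) := by
  have e : V × Bool ≃ Fin (2 * n) :=
    Fintype.equivFinOfCardEq (by simp [hcard, mul_comm])
  let T : V → Set (FreeGroup Bool) := fun v =>
    if c v = 0 then Set.range FreeGroup.of else eventualKernel
  have hT (v : V) : ∃ t ∈ T v, t ≠ 1 := by
    by_cases hv : c v = 0
    · exact ⟨FreeGroup.of true, by simp [T, hv], FreeGroup.of_ne_one _⟩
    · exact ⟨conjCommutator 0, by simpa [T, hv] using conjCommutator_mem_eventualKernel 0,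
        conjCommutator_ne_one 0⟩
  have hle := normalClosure_orderRelators_le_iff e T hT
  refine ⟨fun v => Subgroup.normalClosure (orderRelators e T v), fun u v huv => ?_,
    fun u v => (hle u v).symm, fun v => ⟨Subgroup.normalClosure_normal, ?_⟩⟩
  · exact le_antisymm ((hle u v).1 huv.le) ((hle v u).1 huv.ge)
  · refine (finitelyPresented_quotient_iff _).trans ⟨fun h => ?_, fun hv => ?_⟩
    · by_contra hv
      have := h.map (factorRetraction_surjective e v)
      rw [map_normalClosure_orderRelators] at this
      simp only [T, if_neg hv, Subgroup.normalClosure_eq_self] at this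
      exact not_isFinitelyNormallyGenerated_eventualKernel this
    · refine ⟨_, finite_orderRelators e T ?_, rfl⟩
      simp only [T, if_pos hv]
      exact Set.finite_range _
end

section
/- The free group F of countably infinite rank is quotient-saturated: for every finite set V, every partial order ≤ on V, and every coloring c : V → {0,1}, there exists an assignment of normal subgroups N_v ⊴ F (v ∈ V) such that v ↦ N_v is injective, u ≤ v if and only if N_u ≤ N_v, and F/N_v is finitely presented if and only if c(v) = 0. -/
/-- A group `G` is *quotient-saturated* if every finite partial order equipped with a
`{0,1}`-coloring is realizable in `G` by normal subgroups. -/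
def QuotientSaturated (G : Type*) [Group G] : Prop :=
  ∀ (V : Type) [Fintype V] [PartialOrder V] (c : V → Fin 2),
    ∃ N : V → Subgroup G,
      Function.Injective N ∧
      (∀ u v : V, u ≤ v ↔ N u ≤ N v) ∧
      (∀ v : V, ∃ h : (N v).Normal,
        ((letI := h; FinitelyPresented (G ⧸ N v)) ↔ c v = 0))

open scoped commutatorElement

/-- The kernel of a surjection from a finitely generated group onto a finitely presented group is
the normal closure of a finite set. -/
theorem Group.IsFinitelyPresented.isFinitelyNormallyGenerated_ker {G H : Type*} [Group G] [Group H]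
    [Group.FG G] [hH : Group.IsFinitelyPresented H] (f : G →* H) (hf : Function.Surjective f) :
    f.ker.IsFinitelyNormallyGenerated := by
  obtain ⟨n, ψ, hψ, S, hS, hSψ⟩ := hH.out
  obtain ⟨T, hT, hTfin⟩ := (Group.fg_iff (G := G)).1 inferInstance
  obtain ⟨σ, hσ⟩ : ∃ σ : FreeGroup (Fin n) →* G, f.comp σ = ψ := by
    choose s hs using hf
    exact ⟨FreeGroup.lift fun i => s (ψ (.of i)), FreeGroup.ext_hom _ _ fun i => by simp [hs]⟩
  have hσ' (u) : f (σ u) = ψ u := DFunLike.congr_fun hσ u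
  choose w hw using fun x => hψ (f x)
  set R : Set G := σ '' S ∪ (fun x => x⁻¹ * σ (w x)) '' T
  have hle : Subgroup.normalClosure R ≤ f.ker := by
    refine Subgroup.normalClosure_le_normal ?_
    rintro _ (⟨s, hs, rfl⟩ | ⟨x, -, rfl⟩)
    · have : s ∈ ψ.ker := hSψ ▸ Subgroup.subset_normalClosure hs
      simpa [hσ'] using this
    · simp [MonoidHom.mem_ker, hσ', hw]
  refine ⟨R, (hS.image _).union (hTfin.image _), le_antisymm hle fun g hg => ?_⟩
  have htop : σ.range ⊔ Subgroup.normalClosure R = ⊤ := by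
    rw [eq_top_iff, ← hT, Subgroup.closure_le]
    intro x hx
    have h₁ : x⁻¹ * σ (w x) ∈ Subgroup.normalClosure R :=
      Subgroup.subset_normalClosure (.inr ⟨x, hx, rfl⟩)
    have h₂ : σ (w x) * (x⁻¹ * σ (w x))⁻¹ ∈ σ.range ⊔ Subgroup.normalClosure R :=
      Subgroup.mul_mem_sup ⟨w x, rfl⟩ (inv_mem h₁)
    simpa using h₂
  obtain ⟨_, ⟨u, rfl⟩, m, hm, rfl⟩ :=
    Subgroup.mem_sup_of_normal_right.1 (htop ▸ Subgroup.mem_top g)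
  refine mul_mem ?_ hm
  have hu : u ∈ Subgroup.normalClosure S := by
    have h₁ : f m = 1 := hle hm
    rw [hSψ, MonoidHom.mem_ker, ← hσ']
    simpa [MonoidHom.mem_ker, h₁] using hg
  have hS' : Subgroup.normalClosure S ≤ (Subgroup.normalClosure R).comap σ :=
    Subgroup.normalClosure_le_normal fun s hs =>
      Subgroup.subset_normalClosure (.inl ⟨s, hs, rfl⟩)
  exact hS' hu

/-- A quotient of a finitely presented group is finitely presented if and only if the kernel is the
normal closure of a finite set. -/
theorem Group.isFinitelyPresented_iff_isFinitelyNormallyGenerated_ker {G H : Type*} [Group G]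
    [Group H] [Group.FG G] [Group.IsFinitelyPresented G] (f : G →* H)
    (hf : Function.Surjective f) :
    Group.IsFinitelyPresented H ↔ f.ker.IsFinitelyNormallyGenerated :=
  ⟨fun _ => Group.IsFinitelyPresented.isFinitelyNormallyGenerated_ker f hf,
    Group.IsFinitelyPresented.of_surjective f hf⟩

theorem finitelyPresented_iff_isFinitelyPresented {G : Type*} [Group G] :
    FinitelyPresented G ↔ Group.IsFinitelyPresented G := by
  constructor
  · rintro ⟨n, R, hR, ⟨e⟩⟩
    have := Group.IsFinitelyPresented.quotient (Subgroup.normalClosure R) ⟨R, hR, rfl⟩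
    exact .equiv e
  · intro h
    obtain ⟨n, s, hs, ⟨e⟩⟩ := h.exists_mulEquiv_presentedGroup
    exact ⟨n, s, hs, ⟨e.symm⟩⟩

/-- The normal closure of `A` together with a sequence `r` is not normally generated by a finite
set if no `r n` is a consequence of `A` and the earlier terms. -/
theorem Subgroup.not_isFinitelyNormallyGenerated_of_strictMono {G : Type*} [Group G] (A : Set G)
    (r : ℕ → G) (h : ∀ n, r n ∉ Subgroup.normalClosure (A ∪ r '' Set.Iio n)) :
    ¬ (Subgroup.normalClosure (A ∪ Set.range r)).IsFinitelyNormallyGenerated := by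
  rintro ⟨S, hS, hSr⟩
  have hmono : Monotone fun n => Subgroup.normalClosure (A ∪ r '' Set.Iio n) := fun m n hmn =>
    Subgroup.normalClosure_mono (by gcongr)
  have hle : Subgroup.normalClosure (A ∪ Set.range r) ≤
      ⨆ n, Subgroup.normalClosure (A ∪ r '' Set.Iio n) := by
    refine Subgroup.normalClosure_le_normal ?_
    rintro x (hx | ⟨n, rfl⟩)
    · exact Subgroup.mem_iSup_of_mem 0 (Subgroup.subset_normalClosure (.inl hx))
    · exact Subgroup.mem_iSup_of_mem (n + 1)
        (Subgroup.subset_normalClosure (.inr ⟨n, Nat.lt_succ_self n, rfl⟩))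
  have hmem : ∀ s ∈ S, ∃ n, s ∈ Subgroup.normalClosure (A ∪ r '' Set.Iio n) := fun s hs =>
    (Subgroup.mem_iSup_of_directed hmono.directed_le).1
      (hle (hSr ▸ Subgroup.subset_normalClosure hs))
  choose! k hk using hmem
  obtain ⟨n, hn⟩ := (hS.image k).bddAbove
  refine h n ?_
  have hSn : Subgroup.normalClosure S ≤ Subgroup.normalClosure (A ∪ r '' Set.Iio n) :=
    Subgroup.normalClosure_le_normal fun s hs => hmono (hn ⟨s, hs, rfl⟩) (hk s hs)
  exact hSn (hSr ▸ Subgroup.subset_normalClosure (.inr ⟨n, rfl⟩))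

/-- The relator expressing that `a` commutes with its conjugate by `t ^ (i + 1)`. -/
def shiftCommutator {G : Type*} [Group G] (a t : G) (i : ℕ) : G :=
  ⁅a, t ^ (i + 1) * a * (t ^ (i + 1))⁻¹⁆

theorem map_shiftCommutator {G H : Type*} [Group G] [Group H] (f : G →* H) (a t : G) (i : ℕ) :
    f (shiftCommutator a t i) = shiftCommutator (f a) (f t) i := by
  simp [shiftCommutator, map_commutatorElement]

theorem conj_addRight_swap (n i : ℕ) :
    Equiv.addRight (1 : ℤ) ^ i * Equiv.swap 0 (n : ℤ) * (Equiv.addRight (1 : ℤ) ^ i)⁻¹ =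
      Equiv.swap (i : ℤ) (n + i) := by
  rw [← Equiv.swap_apply_apply]
  simp

theorem shiftCommutator_swap_of_lt {n i : ℕ} (h : i < n) :
    shiftCommutator (Equiv.swap 0 ((n + 1 : ℕ) : ℤ)) (Equiv.addRight (1 : ℤ)) i = 1 := by
  rw [shiftCommutator, conj_addRight_swap, commutatorElement_eq_one_iff_commute]
  refine Equiv.Perm.Disjoint.commute fun x => ?_
  by_cases h₁ : x = 0 ∨ x = (n + 1 : ℕ)
  · exact .inr (Equiv.swap_apply_of_ne_of_ne (by omega) (by omega))
  · exact .inl (Equiv.swap_apply_of_ne_of_ne (by omega) (by omega))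

theorem shiftCommutator_swap_self_ne_one (n : ℕ) :
    shiftCommutator (Equiv.swap 0 ((n + 1 : ℕ) : ℤ)) (Equiv.addRight (1 : ℤ)) n ≠ 1 := by
  rw [shiftCommutator, conj_addRight_swap, Ne, commutatorElement_eq_one_iff_mul_comm]
  intro h
  have h₀ := DFunLike.congr_fun h 0
  have hfix : Equiv.swap ((n + 1 : ℕ) : ℤ) ((n + 1 : ℕ) + (n + 1 : ℕ)) 0 = 0 :=
    Equiv.swap_apply_of_ne_of_ne (by omega) (by omega)
  rw [Equiv.Perm.mul_apply, Equiv.Perm.mul_apply, hfix, Equiv.swap_apply_left,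
    Equiv.swap_apply_left] at h₀
  omega

section ColoredPoset

variable {V : Type}

/-- The two generators of the `w`-th free factor. -/
def factorGenerators (w : V) : Set (FreeGroup (V × Bool)) :=
  {.of (w, false), .of (w, true)}

/-- The sequence of relators in the `w`-th free factor. -/
def factorRelator (w : V) : ℕ → FreeGroup (V × Bool) :=
  shiftCommutator (.of (w, false)) (.of (w, true))

open Classical in
/-- The homomorphism killing all factors but the `w`-th, on which the two generators act as a
transposition and a translation of `ℤ`. -/
noncomputable def factorHom (w : V) (n : ℕ) : FreeGroup (V × Bool) →* Equiv.Perm ℤ :=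
  FreeGroup.lift fun x => if x.1 = w then
    (if x.2 then Equiv.addRight 1 else Equiv.swap 0 ((n + 1 : ℕ) : ℤ)) else 1

theorem factorHom_factorRelator_of_lt (w : V) {n i : ℕ} (h : i < n) :
    factorHom w n (factorRelator w i) = 1 := by
  rw [factorRelator, map_shiftCommutator]
  simpa [factorHom] using shiftCommutator_swap_of_lt h

theorem factorHom_factorRelator_self (w : V) (n : ℕ) :
    factorHom w n (factorRelator w n) ≠ 1 := by
  rw [factorRelator, map_shiftCommutator]
  simpa [factorHom] using shiftCommutator_swap_self_ne_one n

theorem factorHom_of_mem_factorGenerators {v w : V} (h : w ≠ v) (n : ℕ)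
    {x : FreeGroup (V × Bool)} (hx : x ∈ factorGenerators w) : factorHom v n x = 1 := by
  rcases hx with rfl | rfl <;> simp [factorHom, h]

theorem factorRelator_mem {w : V} {N : Subgroup (FreeGroup (V × Bool))}
    (h : factorGenerators w ⊆ N) (n : ℕ) : factorRelator w n ∈ N := by
  have ha : FreeGroup.of (w, false) ∈ N := h (.inl rfl)
  have ht : FreeGroup.of (w, true) ∈ N := h (.inr rfl)
  have hc := mul_mem (mul_mem (pow_mem ht (n + 1)) ha) (inv_mem (pow_mem ht (n + 1)))
  exact mul_mem (mul_mem (mul_mem ha hc) (inv_mem ha)) (inv_mem hc)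

variable [PartialOrder V]

/-- The relators attached to `v`: all factors strictly below `v` are killed, and the factor of `v`
is killed or made into an infinitely presented group according to the color of `v`. -/
def posetRelators (c : V → Fin 2) (v : V) : Set (FreeGroup (V × Bool)) :=
  (⋃ w ∈ Set.Iio v, factorGenerators w) ∪
    if c v = 0 then factorGenerators v else Set.range (factorRelator v)

theorem factorRelator_mem_normalClosure_posetRelators (c : V → Fin 2) (v : V) (n : ℕ) :
    factorRelator v n ∈ Subgroup.normalClosure (posetRelators c v) := by
  by_cases hv : c v = 0
  · refine factorRelator_mem (fun x hx => Subgroup.subset_normalClosure (.inr ?_)) n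
    rwa [if_pos hv]
  · refine Subgroup.subset_normalClosure (.inr ?_)
    rw [if_neg hv]
    exact ⟨n, rfl⟩

theorem normalClosure_posetRelators_mono (c : V → Fin 2) {u v : V} (huv : u ≤ v) :
    Subgroup.normalClosure (posetRelators c u) ≤ Subgroup.normalClosure (posetRelators c v) := by
  rcases huv.eq_or_lt with rfl | huv
  · rfl
  have hgen (w : V) (hw : w < v) :
      factorGenerators w ⊆ Subgroup.normalClosure (posetRelators c v) := fun x hx =>
    Subgroup.subset_normalClosure (.inl (Set.mem_biUnion hw hx))
  refine Subgroup.normalClosure_le_normal (Set.union_subset ?_ ?_)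
  · exact Set.iUnion₂_subset fun w hw => hgen w (lt_trans hw huv)
  · split_ifs
    · exact hgen u huv
    · rintro _ ⟨n, rfl⟩
      exact factorRelator_mem (hgen u huv) n

theorem normalClosure_posetRelators_le_ker {u v : V} (c : V → Fin 2) (huv : ¬ u ≤ v) (n : ℕ) :
    Subgroup.normalClosure (posetRelators c v) ≤ (factorHom u n).ker := by
  have hgen (w : V) (hw : w ≤ v) : factorGenerators w ⊆ (factorHom u n).ker := fun x hx =>
    factorHom_of_mem_factorGenerators (by rintro rfl; exact huv hw) n hx
  refine Subgroup.normalClosure_le_normal (Set.union_subset ?_ ?_)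
  · exact Set.iUnion₂_subset fun w hw => hgen w (le_of_lt hw)
  · split_ifs
    · exact hgen v le_rfl
    · rintro _ ⟨i, rfl⟩
      exact factorRelator_mem (hgen v le_rfl) i

theorem normalClosure_posetRelators_le_iff (c : V → Fin 2) (u v : V) :
    Subgroup.normalClosure (posetRelators c u) ≤ Subgroup.normalClosure (posetRelators c v) ↔
      u ≤ v := by
  refine ⟨fun h => ?_, normalClosure_posetRelators_mono c⟩
  by_contra huv
  exact factorHom_factorRelator_self u 0 (normalClosure_posetRelators_le_ker c huv 0
    (h (factorRelator_mem_normalClosure_posetRelators c u 0)))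

theorem isFinitelyNormallyGenerated_posetRelators_iff [Finite V] (c : V → Fin 2) (v : V) :
    (Subgroup.normalClosure (posetRelators c v)).IsFinitelyNormallyGenerated ↔ c v = 0 := by
  constructor
  · contrapose
    intro hv
    rw [posetRelators, if_neg hv]
    refine Subgroup.not_isFinitelyNormallyGenerated_of_strictMono _ _ fun n hn => ?_
    refine factorHom_factorRelator_self v n
      ((Subgroup.normalClosure_le_normal (N := (factorHom v n).ker)
        (Set.union_subset ?_ ?_)) hn)
    · exact Set.iUnion₂_subset fun w hw x hx => factorHom_of_mem_factorGenerators (ne_of_lt hw) n hx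
    · rintro _ ⟨i, hi, rfl⟩
      exact factorHom_factorRelator_of_lt v hi
  · intro hv
    refine ⟨posetRelators c v, ?_, rfl⟩
    rw [posetRelators, if_pos hv]
    have hfin (w : V) : (factorGenerators w).Finite := by simp [factorGenerators]
    exact ((Set.toFinite _).biUnion fun w _ => hfin w).union (hfin v)

end ColoredPoset

/-- The free group of countably infinite rank is quotient-saturated. -/
theorem stmt_2 : QuotientSaturated (FreeGroup ℕ) := by
  intro V _ _ c
  obtain ⟨s, hs⟩ := exists_surjective_nat (FreeGroup (V × Bool))
  set π : FreeGroup ℕ →* FreeGroup (V × Bool) := FreeGroup.lift s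
  have hπ : Function.Surjective π := fun x => by
    obtain ⟨k, rfl⟩ := hs x
    exact ⟨.of k, by simp [π]⟩
  have hle (u v : V) : u ≤ v ↔ (Subgroup.normalClosure (posetRelators c u)).comap π ≤
      (Subgroup.normalClosure (posetRelators c v)).comap π := by
    rw [Subgroup.comap_le_comap_of_surjective hπ, normalClosure_posetRelators_le_iff]
  refine ⟨fun v => (Subgroup.normalClosure (posetRelators c v)).comap π, fun u v huv => ?_, hle,
    fun v => ⟨inferInstance, ?_⟩⟩
  · exact le_antisymm ((hle u v).2 huv.le) ((hle v u).2 huv.ge)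
  · set M := Subgroup.normalClosure (posetRelators c v) with hM
    have hker : ((QuotientGroup.mk' M).comp π).ker = M.comap π := by
      rw [← MonoidHom.comap_ker, QuotientGroup.ker_mk']
    let e : FreeGroup ℕ ⧸ M.comap π ≃* FreeGroup (V × Bool) ⧸ M :=
      (QuotientGroup.quotientMulEquivOfEq hker.symm).trans
        (QuotientGroup.quotientKerEquivOfSurjective _
          ((QuotientGroup.mk'_surjective M).comp hπ))
    have he : Group.IsFinitelyPresented (FreeGroup ℕ ⧸ M.comap π) ↔
        Group.IsFinitelyPresented (FreeGroup (V × Bool) ⧸ M) :=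
      ⟨fun _ => .equiv e, fun _ => .equiv e.symm⟩
    rw [finitelyPresented_iff_isFinitelyPresented, he,
      Group.isFinitelyPresented_iff_isFinitelyNormallyGenerated_ker (QuotientGroup.mk' M)
        (QuotientGroup.mk'_surjective M), QuotientGroup.ker_mk', hM]
    exact isFinitelyNormallyGenerated_posetRelators_iff c v
end

section
/- Let F be the free group with basis {a, b}, let H be the subgroup of F generated by {a, b⁻¹ab}, and let R = {b⁻¹ab}. Then H is contained in the normal closure ⟪R⟫_F of R in F (so H ∩ ⟪R⟫_F = H), but a does not belong to the normal closure ⟪R⟫_H of R in H; in particular ⟪R⟫_H ≠ H ∩ ⟪R⟫_F, so the extension H ≤ F does not satisfy the Congruence Extension Property. -/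
/-- The free group on `{a, b}`. -/
noncomputable def Fab : Type := FreeGroup (Fin 2)

noncomputable instance : Group Fab := by unfold Fab; infer_instance

/-- The generator `a`. -/
noncomputable def a : Fab := FreeGroup.of 0

/-- The generator `b`. -/
noncomputable def b : Fab := FreeGroup.of 1

/-- The subgroup `H = ⟨a, b⁻¹ab⟩` of `F = F(a,b)`. -/
noncomputable def Hab : Subgroup Fab := Subgroup.closure {a, b⁻¹ * a * b}

/-- The homomorphism from `Fab` to the wreath product `C₂ ≀ C₂`, acting on four points, that
sends `a` to a generator of one factor `C₂` and `b` to the exchange of the two factors. -/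
noncomputable def toWreath : Fab →* Equiv.Perm (Fin 4) :=
  (FreeGroup.lift ![Equiv.swap 0 1, Equiv.swap 0 2 * Equiv.swap 1 3] :
    FreeGroup (Fin 2) →* Equiv.Perm (Fin 4))

theorem toWreath_a : toWreath a = Equiv.swap 0 1 :=
  FreeGroup.lift_apply_of

theorem toWreath_b : toWreath b = Equiv.swap 0 2 * Equiv.swap 1 3 :=
  FreeGroup.lift_apply_of

theorem toWreath_conj : toWreath (b⁻¹ * a * b) = Equiv.swap 2 3 := by
  rw [map_mul, map_mul, map_inv, toWreath_a, toWreath_b]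
  decide

theorem commute_toWreath_of_mem_Hab {h : Fab} (hh : h ∈ Hab) :
    Commute (toWreath h) (Equiv.swap 2 3) := by
  induction hh using Subgroup.closure_induction with
  | mem x hx =>
    rcases hx with rfl | rfl
    · rw [toWreath_a, commute_iff_eq]
      decide
    · rw [toWreath_conj]
  | one => rw [map_one]; exact Commute.one_left _
  | mul x y _ _ hx hy => rw [map_mul]; exact hx.mul_left hy
  | inv x _ hx => rw [map_inv]; exact hx.inv_left

theorem Hab_le_normalClosure : Hab ≤ Subgroup.normalClosure {b⁻¹ * a * b} := by
  have hr : b⁻¹ * a * b ∈ Subgroup.normalClosure {b⁻¹ * a * b} :=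
    Subgroup.subset_normalClosure rfl
  refine (Subgroup.closure_le _).2 ?_
  rintro x (rfl | rfl)
  · simpa [mul_assoc] using Subgroup.normalClosure_normal.conj_mem _ hr b
  · exact hr

theorem a_mem_Hab : a ∈ Hab :=
  Subgroup.subset_closure (Or.inl rfl)

theorem toWreath_fixes_zero {x : Hab}
    (hx : x ∈ Subgroup.normalClosure (Subtype.val ⁻¹' {b⁻¹ * a * b} : Set Hab)) :
    toWreath x 0 = 0 := by
  have hle : Subgroup.normalClosure (Subtype.val ⁻¹' {b⁻¹ * a * b} : Set Hab) ≤
      (MulAction.stabilizer (Equiv.Perm (Fin 4)) (0 : Fin 4)).comap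
        (toWreath.comp Hab.subtype) := by
    refine (Subgroup.closure_le _).2 fun y hy => ?_
    obtain ⟨r, hr, hry⟩ := Group.mem_conjugatesOfSet_iff.1 hy
    obtain ⟨h, rfl⟩ := isConj_iff.1 hry
    have hr' : (r : Fab) = b⁻¹ * a * b := hr
    have key : toWreath ((h * r * h⁻¹ : Hab) : Fab) = Equiv.swap 2 3 := by
      rw [Subgroup.coe_mul, Subgroup.coe_mul, Subgroup.coe_inv, map_mul, map_mul, map_inv, hr',
        toWreath_conj, (commute_toWreath_of_mem_Hab h.2).eq, mul_inv_cancel_right]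
    change toWreath ((h * r * h⁻¹ : Hab) : Fab) 0 = 0
    rw [key]
    decide
  exact hle hx

theorem a_notMem_map_normalClosure :
    a ∉ (Subgroup.normalClosure
      (Subtype.val ⁻¹' {b⁻¹ * a * b} : Set Hab)).map Hab.subtype := by
  rintro ⟨x, hx, hxa⟩
  have h0 := toWreath_fixes_zero hx
  rw [show (x : Fab) = a from hxa, toWreath_a] at h0
  exact absurd h0 (by decide)

/-- With `F = F(a, b)`, `H = ⟨a, b⁻¹ab⟩` and `R = {b⁻¹ab}`: `H` is contained in the
normal closure `⟪R⟫_F` (so `H ∩ ⟪R⟫_F = H`), but `a` does not belong to the normal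
closure `⟪R⟫_H` of `R` in `H`; in particular `⟪R⟫_H ≠ H ∩ ⟪R⟫_F`, so `H ≤ F` does
not satisfy the Congruence Extension Property. -/
theorem stmt_8 :
    Hab ≤ Subgroup.normalClosure {b⁻¹ * a * b} ∧
    Subgroup.normalClosure {b⁻¹ * a * b} ⊓ Hab = Hab ∧
    a ∉ (Subgroup.normalClosure
          (Subtype.val ⁻¹' {b⁻¹ * a * b} : Set Hab)).map Hab.subtype ∧
    (Subgroup.normalClosure (Subtype.val ⁻¹' {b⁻¹ * a * b} : Set Hab)).map Hab.subtype ≠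
      Subgroup.normalClosure {b⁻¹ * a * b} ⊓ Hab := by
  have hinf : Subgroup.normalClosure {b⁻¹ * a * b} ⊓ Hab = Hab :=
    inf_eq_right.2 Hab_le_normalClosure
  refine ⟨Hab_le_normalClosure, hinf, a_notMem_map_normalClosure, fun h => ?_⟩
  apply a_notMem_map_normalClosure
  rw [h, hinf]
  exact a_mem_Hab
end

section
/- For a group G, the following are equivalent: (a) G contains a subgroup isomorphic to the free group of rank 2 that satisfies CEP as a subgroup of G; (b) for every finite n ≥ 2 and also for n = ℵ₀ (countably infinite rank), G contains a subgroup isomorphic to the free group of rank n that satisfies CEP as a subgroup of G. -/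
/-- A subgroup `H ≤ G` satisfies the *Congruence Extension Property* (CEP) if for
every subset `R ⊆ H`, the normal closure of `R` in `H` equals `H ∩ ⟪R⟫_G`
(expressed as the pullback of the normal closure of `R` in `G` along `H ↪ G`). -/
def IsCEP {G : Type*} [Group G] (H : Subgroup G) : Prop :=
  ∀ R : Set H, Subgroup.normalClosure R =
    (Subgroup.normalClosure (Subtype.val '' R)).comap H.subtype

open Function Subgroup
open scoped commutatorElement

universe u

namespace CEP

/-- An injective homomorphism whose range has the congruence extension property. -/
structure IsCEPHom {A B : Type*} [Group A] [Group B] (θ : A →* B) : Prop where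
  injective : Injective θ
  comap_le : ∀ R : Set A, (normalClosure (θ '' R)).comap θ ≤ normalClosure R

namespace IsCEPHom

variable {A B C : Type*} [Group A] [Group B] [Group C]

lemma comp {η : B →* C} {θ : A →* B} (hη : IsCEPHom η) (hθ : IsCEPHom θ) :
    IsCEPHom (η.comp θ) where
  injective := hη.injective.comp hθ.injective
  comap_le R x hx := by
    refine hθ.comap_le R (hη.comap_le (θ '' R) ?_)
    simpa [Set.image_image] using hx

lemma of_leftInverse {θ : A →* B} (ρ : B →* A) (h : LeftInverse ρ θ) : IsCEPHom θ where
  injective := h.injective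
  comap_le R x hx := by
    have hle : normalClosure (θ '' R) ≤ (normalClosure R).comap ρ := by
      refine normalClosure_le_normal ?_
      rintro _ ⟨r, hr, rfl⟩
      simpa [h r] using subset_normalClosure hr
    simpa [h x] using hle hx

lemma of_mulEquiv (e : A ≃* B) : IsCEPHom e.toMonoidHom :=
  of_leftInverse e.symm.toMonoidHom e.symm_apply_apply

/-- If every homomorphism `A →* Q` extends along `θ` after enlarging `Q`, then `θ` has CEP. -/
lemma of_extension {A : Type u} [Group A] {θ : A →* B}
    (h : ∀ (Q : Type u) [Group Q] (ψ : A →* Q), ∃ (E : Type u) (_ : Group E) (ι : Q →* E)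
      (Ψ : B →* E), Injective ι ∧ ∀ a, Ψ (θ a) = ι (ψ a)) : IsCEPHom θ where
  injective := by
    obtain ⟨E, _, ι, Ψ, hι, hΨ⟩ := h A (MonoidHom.id A)
    intro a b hab
    apply hι
    simpa [hΨ] using congrArg Ψ hab
  comap_le R x hx := by
    obtain ⟨E, _, ι, Ψ, hι, hΨ⟩ := h (A ⧸ normalClosure R) (QuotientGroup.mk' _)
    have hle : normalClosure (θ '' R) ≤ Ψ.ker := by
      refine normalClosure_le_normal ?_
      rintro _ ⟨r, hr, rfl⟩
      have hr' : (QuotientGroup.mk' (normalClosure R)) r = 1 :=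
        (QuotientGroup.eq_one_iff r).2 (subset_normalClosure hr)
      change Ψ (θ r) = 1
      rw [hΨ, hr', map_one]
    have hx' : Ψ (θ x) = 1 := hle hx
    rw [hΨ] at hx'
    exact (QuotientGroup.eq_one_iff x).1 (hι (hx'.trans ι.map_one.symm))

end IsCEPHom

lemma isCEPHom_subtype_iff {G : Type*} [Group G] {H : Subgroup G} :
    IsCEPHom H.subtype ↔ IsCEP H := by
  refine ⟨fun h R => le_antisymm ?_ (h.comap_le R), fun h => ⟨H.subtype_injective, fun R => ?_⟩⟩
  · exact normalClosure_le_normal fun r hr => subset_normalClosure ⟨r, hr, rfl⟩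
  · exact (h R).ge

lemma IsCEPHom.exists_subgroup {A G : Type*} [Group A] [Group G] {θ : A →* G}
    (h : IsCEPHom θ) : ∃ H : Subgroup G, IsCEP H ∧ Nonempty (H ≃* A) := by
  let e := MonoidHom.ofInjective h.injective
  refine ⟨θ.range, isCEPHom_subtype_iff.1 ?_, ⟨e.symm⟩⟩
  have hcomp : θ.range.subtype = θ.comp e.symm.toMonoidHom := by
    ext x
    obtain ⟨a, rfl⟩ := e.surjective x
    simpa using MonoidHom.ofInjective_apply h.injective
  rw [hcomp]
  exact h.comp (.of_mulEquiv e.symm)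

/-- The action of `ℤ → P` on `ℤ × P` by fibrewise left multiplication. -/
def fibrewiseMul (P : Type*) [Group P] : (ℤ → P) →* Equiv.Perm (ℤ × P) where
  toFun f :=
    { toFun := fun x => (x.1, f x.1 * x.2)
      invFun := fun x => (x.1, (f x.1)⁻¹ * x.2)
      left_inv := fun x => by simp
      right_inv := fun x => by simp }
  map_one' := by ext x <;> simp
  map_mul' f g := by ext x <;> simp [mul_assoc]

lemma fibrewiseMul_injective (P : Type*) [Group P] : Injective (fibrewiseMul P) := by
  intro f g h
  ext n
  simpa [fibrewiseMul] using congrArg Prod.snd (Equiv.congr_fun h (n, 1))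

/-- Translation by `-1` in the first factor of `ℤ × P`. -/
def shift (P : Type*) : Equiv.Perm (ℤ × P) :=
  (Equiv.addRight (-1 : ℤ)).prodCongr (Equiv.refl P)

lemma shift_mul_fibrewiseMul {P : Type*} [Group P] (f : ℤ → P) :
    shift P * fibrewiseMul P f = fibrewiseMul P (fun n => f (n + 1)) * shift P := by
  ext x <;> simp [shift, fibrewiseMul]

lemma shift_pow_conj {P : Type*} [Group P] (f : ℤ → P) (k : ℕ) :
    shift P ^ k * fibrewiseMul P f * (shift P ^ k)⁻¹ = fibrewiseMul P fun n => f (n + k) := by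
  induction k generalizing f with
  | zero => simp
  | succ k ih =>
    rw [mul_inv_eq_iff_eq_mul, pow_succ, mul_assoc, shift_mul_fibrewiseMul, ← mul_assoc,
      ← mul_assoc, mul_inv_eq_iff_eq_mul.1 (ih fun n => f (n + 1))]
    simp [add_assoc]

/-- The embedding of `P` at position `n`. -/
def singleHom (P : Type*) [Group P] (n : ℤ) : P →* Equiv.Perm (ℤ × P) :=
  (fibrewiseMul P).comp (MonoidHom.mulSingle (fun _ : ℤ => P) n)

lemma singleHom_injective (P : Type*) [Group P] (n : ℤ) : Injective (singleHom P n) :=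
  (fibrewiseMul_injective P).comp (Pi.mulSingle_injective (M := fun _ : ℤ => P) n)

/-- The element of the wreath product with constant value `q` on the nonnegative integers. -/
def halfLine {P : Type*} [Group P] (q : P) : Equiv.Perm (ℤ × P) :=
  fibrewiseMul P fun n => if 0 ≤ n then q else 1

lemma commutator_shift_halfLine {P : Type*} [Group P] (q : P) :
    ⁅shift P, halfLine q⁆ = singleHom P (-1) q := by
  have h := shift_pow_conj (fun n : ℤ => if 0 ≤ n then q else 1) 1
  rw [pow_one] at h
  rw [commutatorElement_def, halfLine, h, ← map_inv, ← map_mul, singleHom]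
  refine congrArg (fibrewiseMul P) (funext fun n => ?_)
  rcases lt_trichotomy n (-1) with hn | rfl | hn
  · simp [show ¬ 0 ≤ n + 1 by omega, show ¬ 0 ≤ n by omega, Pi.mulSingle_eq_of_ne hn.ne]
  · simp
  · simp [show 0 ≤ n + 1 by omega, show 0 ≤ n by omega, Pi.mulSingle_eq_of_ne hn.ne']

/-- Words freely generating a CEP subgroup of the free group of rank two. -/
def word (i : ℕ) : FreeGroup (Fin 2) :=
  ⁅(FreeGroup.of 0 ^ 1 * FreeGroup.of 1 * (FreeGroup.of 0 ^ 1)⁻¹ : FreeGroup (Fin 2)),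
    (FreeGroup.of 0 ^ 2 ^ (i + 1) * FreeGroup.of 1 * (FreeGroup.of 0 ^ 2 ^ (i + 1))⁻¹ :
      FreeGroup (Fin 2))⁆

/-- The function taking the value `c j` at `2 ^ j` and `1` elsewhere. -/
noncomputable def spread {P : Type*} [Group P] (c : ℕ → P) : ℤ → P :=
  extend (fun j : ℕ => (2 : ℤ) ^ j) c 1

lemma spread_two_pow {P : Type*} [Group P] (c : ℕ → P) (j : ℕ) : spread c (2 ^ j) = c j :=
  (pow_right_injective₀ (by norm_num) (by norm_num)).extend_apply c 1 j

lemma commutator_spread {P : Type*} [Group P] (c : ℕ → P) (i : ℕ) (n : ℤ) :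
    ⁅spread c (n + 1), spread c (n + 2 ^ (i + 1))⁆ =
      Pi.mulSingle (M := fun _ : ℤ => P) 0 ⁅c 0, c (i + 1)⁆ n := by
  rcases eq_or_ne n 0 with rfl | hn
  · have h := spread_two_pow c 0
    rw [pow_zero] at h
    simp [h, spread_two_pow]
  rw [Pi.mulSingle_eq_of_ne hn]
  by_cases ha : ∃ a : ℕ, (2 : ℤ) ^ a = n + 1
  · by_cases hb : ∃ b : ℕ, (2 : ℤ) ^ b = n + 2 ^ (i + 1)
    · obtain ⟨a, ha⟩ := ha
      obtain ⟨b, hb⟩ := hb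
      rcases a with _ | a
      · exact absurd (by simpa using ha) hn
      rcases b with _ | b
      · have h1 : (0 : ℤ) < 2 ^ a := by positivity
        have h2 : (0 : ℤ) < 2 ^ i := by positivity
        rw [pow_succ] at ha hb
        omega
      · rw [pow_succ] at ha hb
        rw [pow_succ] at hb
        omega
    · rw [spread, extend_apply' _ _ (n + 2 ^ (i + 1)) hb]
      simp
  · rw [spread, extend_apply' _ _ (n + 1) ha]
    simp

/-- The equations `word i = q i` are simultaneously solvable over every group. -/
lemma exists_extension_word {Q : Type u} [Group Q] (q : ℕ → Q) :
    ∃ (E : Type u) (_ : Group E) (ι : Q →* E) (Ψ : FreeGroup (Fin 2) →* E),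
      Injective ι ∧ ∀ i, Ψ (word i) = ι (q i) := by
  let P := Equiv.Perm (ℤ × Q)
  let c : ℕ → P := fun j => Nat.casesOn j (shift Q) fun i => halfLine (q i)
  refine ⟨Equiv.Perm (ℤ × P), inferInstance, (singleHom P 0).comp (singleHom Q (-1)),
    FreeGroup.lift ![shift P, fibrewiseMul P (spread c)],
    (singleHom_injective P 0).comp (singleHom_injective Q (-1)), fun i => ?_⟩
  have hword : FreeGroup.lift ![shift P, fibrewiseMul P (spread c)] (word i) =
      fibrewiseMul P fun n => ⁅spread c (n + 1), spread c (n + 2 ^ (i + 1))⁆ := by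
    simp only [word, map_commutatorElement, map_mul, map_inv, map_pow, FreeGroup.lift_apply_of,
      Matrix.cons_val_zero, Matrix.cons_val_one, shift_pow_conj]
    rw [← map_commutatorElement]
    refine congrArg (fibrewiseMul P) (funext fun n => ?_)
    simp [commutatorElement_def]
  rw [hword, MonoidHom.comp_apply, ← commutator_shift_halfLine]
  exact congrArg (fibrewiseMul P) (funext fun n => commutator_spread c i n)

lemma isCEPHom_lift_word : IsCEPHom (FreeGroup.lift word) := by
  refine .of_extension fun Q _ ψ => ?_
  obtain ⟨E, hE, ι, Ψ, hι, hΨ⟩ := exists_extension_word fun i => ψ (FreeGroup.of i)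
  refine ⟨E, hE, ι, Ψ, hι, fun a => ?_⟩
  have h : Ψ.comp (FreeGroup.lift word) = ι.comp ψ := by
    ext i
    simp [hΨ]
  exact DFunLike.congr_fun h a

lemma isCEPHom_freeGroup_map {α β : Type*} [Nonempty α] {f : α → β} (hf : Injective f) :
    IsCEPHom (FreeGroup.map f) := by
  refine .of_leftInverse (FreeGroup.map (invFun f)) fun x => ?_
  rw [FreeGroup.map.comp, (leftInverse_invFun hf).comp_eq_id, FreeGroup.map.id]

end CEP

/-- A group `G` contains a CEP free subgroup of rank `2` if and only if it contains
a CEP free subgroup of every rank `2 ≤ n ≤ ℵ₀`. -/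
theorem stmt_9 {G : Type*} [Group G] :
    (∃ H : Subgroup G, IsCEP H ∧ Nonempty (H ≃* FreeGroup (Fin 2))) ↔
    ((∀ n : ℕ, 2 ≤ n → ∃ H : Subgroup G, IsCEP H ∧ Nonempty (H ≃* FreeGroup (Fin n))) ∧
      (∃ H : Subgroup G, IsCEP H ∧ Nonempty (H ≃* FreeGroup ℕ))) := by
  refine ⟨?_, fun h => h.1 2 le_rfl⟩
  rintro ⟨H, hH, ⟨e⟩⟩
  have hω : CEP.IsCEPHom
      ((H.subtype.comp e.symm.toMonoidHom).comp (FreeGroup.lift CEP.word)) :=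
    ((CEP.isCEPHom_subtype_iff.2 hH).comp (.of_mulEquiv e.symm)).comp CEP.isCEPHom_lift_word
  refine ⟨fun n hn => ?_, hω.exists_subgroup⟩
  have : Nonempty (Fin n) := ⟨⟨0, by omega⟩⟩
  exact (hω.comp (CEP.isCEPHom_freeGroup_map (Fin.val_injective (n := n)))).exists_subgroup
end

section
/- Let F be a finitely generated free group, let D be a non-abelian subgroup of F, and let n ≥ 2 be finite. Then there exists a subgroup H ≤ D isomorphic to the free group of rank n such that H satisfies CEP as a subgroup of F. -/
universe u

open Filter
open scoped commutatorElement

/-- A tuple `w` of elements of `F` is *universally solvable* if the system `w i = q i` can be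
solved over every group `Q` for all right-hand sides `q`: some homomorphism from `F` to an
overgroup of `Q` maps each `w i` to `q i`. -/
def UniversallySolvable {ι : Type*} {F : Type*} [Group F] (w : ι → F) : Prop :=
  ∀ (Q : Type u) [Group Q] (q : ι → Q), ∃ (G : Type u) (_ : Group G) (j : Q →* G) (φ : F →* G),
    Function.Injective j ∧ ∀ i, φ (w i) = j (q i)

theorem UniversallySolvable.isCEP_range_lift {ι : Type*} {F : Type u} [Group F] {w : ι → F}
    (hw : UniversallySolvable.{u} w) : IsCEP (FreeGroup.lift w).range := by
  intro R
  apply le_antisymm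
  · exact Subgroup.normalClosure_le_normal fun x hx =>
      Subgroup.subset_normalClosure ⟨x, hx, rfl⟩
  · intro x hx
    obtain ⟨G, _, j, φ, hj, hφ⟩ := hw ((FreeGroup.lift w).range ⧸ Subgroup.normalClosure R)
      fun i => QuotientGroup.mk ((FreeGroup.lift w).rangeRestrict (FreeGroup.of i))
    have key (y : (FreeGroup.lift w).range) : φ y = j (QuotientGroup.mk y) := by
      obtain ⟨v, rfl⟩ := (FreeGroup.lift w).rangeRestrict_surjective y
      have : φ.comp (FreeGroup.lift w) =
          (j.comp (QuotientGroup.mk' _)).comp (FreeGroup.lift w).rangeRestrict := by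
        ext i
        simp [hφ]
      exact DFunLike.congr_fun this v
    have hker : Subgroup.normalClosure (Subtype.val '' R) ≤ φ.ker := by
      refine Subgroup.normalClosure_le_normal ?_
      rintro _ ⟨y, hy, rfl⟩
      rw [SetLike.mem_coe, MonoidHom.mem_ker, key,
        (QuotientGroup.eq_one_iff y).2 (Subgroup.subset_normalClosure hy), map_one]
    have hx1 : j (QuotientGroup.mk x) = 1 := by
      rw [← key]
      exact hker hx
    exact (QuotientGroup.eq_one_iff x).1 ((map_eq_one_iff j hj).1 hx1)

theorem UniversallySolvable.lift_injective {ι : Type} {F : Type u} [Group F] {w : ι → F}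
    (hw : UniversallySolvable.{u} w) : Function.Injective (FreeGroup.lift w) := by
  obtain ⟨G, _, j, φ, hj, hφ⟩ := hw (FreeGroup (ULift.{u} ι)) fun i => FreeGroup.of ⟨i⟩
  have : φ.comp (FreeGroup.lift w) = j.comp (FreeGroup.map ULift.up) := by
    ext i
    simp [hφ]
  refine Function.Injective.of_comp (f := φ) ?_
  rw [← MonoidHom.coe_comp, this, MonoidHom.coe_comp]
  exact hj.comp (FreeGroup.map_injective ULift.up_injective)

namespace RegularWreathProduct

variable {B P : Type*} [Group B] [Group P]

/-- The copy of `B` in the base group of `B ≀ᵣ P` consisting of the functions supported at `a`. -/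
noncomputable def baseSingle (a : P) : B →* B ≀ᵣ P := by
  classical
  exact
    { toFun := fun b => ⟨Pi.mulSingle a b, 1⟩
      map_one' := by ext <;> simp
      map_mul' := fun b c => by ext <;> simp [Pi.mulSingle_mul] }

theorem baseSingle_left [DecidableEq P] (a : P) (b : B) :
    (baseSingle a b).left = Pi.mulSingle a b := by
  simp only [baseSingle, MonoidHom.coe_mk, OneHom.coe_mk]
  congr!

@[simp]
theorem baseSingle_right (a : P) (b : B) : (baseSingle a b).right = 1 := rfl

theorem baseSingle_injective (a : P) : Function.Injective (baseSingle (B := B) a) := by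
  classical
  intro b c h
  have := congrArg (fun g => g.left a) h
  simpa [baseSingle_left] using this

/-- The hom into the base group of functions constant on `S` and trivial off `S`. -/
noncomputable def baseIndicator (S : Set P) : B →* B ≀ᵣ P := by
  classical
  exact
    { toFun := fun b => ⟨fun x => if x ∈ S then b else 1, 1⟩
      map_one' := by ext <;> simp
      map_mul' := fun b c => by ext <;> simp; split_ifs <;> simp }

open Classical in
theorem baseIndicator_left (S : Set P) (b : B) (x : P) :
    (baseIndicator S b).left x = if x ∈ S then b else 1 := rfl

@[simp]
theorem baseIndicator_right (S : Set P) (b : B) : (baseIndicator S b).right = 1 := rfl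

theorem commute_baseIndicator {S T : Set P} (h : Disjoint S T) (b c : B) :
    Commute (baseIndicator S b) (baseIndicator T c) := by
  ext x
  · have : x ∈ S → x ∉ T := fun hS hT => Set.disjoint_left.1 h hS hT
    by_cases hS : x ∈ S <;> by_cases hT : x ∈ T <;> simp_all [baseIndicator_left]
  · simp

theorem conj_left (w v : B ≀ᵣ P) (hv : v.right = 1) (x : P) :
    (w * v * w⁻¹).left x = w.left x * v.left (w.right⁻¹ * x) * (w.left x)⁻¹ := by
  simp [hv, mul_assoc]

theorem commutator_left (v w : B ≀ᵣ P) (hv : v.right = 1) (hw : w.right = 1) (x : P) :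
    ⁅v, w⁆.left x = ⁅v.left x, w.left x⁆ := by
  simp [commutatorElement_def, hv, hw, mul_assoc]

theorem commutator_right (v w : B ≀ᵣ P) (hv : v.right = 1) (hw : w.right = 1) :
    ⁅v, w⁆.right = 1 := by
  simp [commutatorElement_def, hv, hw]

end RegularWreathProduct

open RegularWreathProduct

/-- Over every group, every element is a commutator `⁅s ^ c, r⁆` with `s` independent of the
element, in two ways that commute with each other. -/
theorem exists_commutator_extension (Q : Type u) [Group Q] {c : ℤ} (hc : c ≠ 0) :
    ∃ (G : Type u) (_ : Group G) (j : Q →* G) (s : G) (r r' : Q →* G), Function.Injective j ∧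
      (∀ q, ⁅s ^ c, r q⁻¹⁆ = j q) ∧ (∀ q, ⁅s ^ c, r' q⁆ = j q) ∧
      ∀ q q', Commute (r q) (r' q') := by
  classical
  let Z := Multiplicative ℤ
  let S : Set Z := {x | ∃ k : ℤ, 0 ≤ k ∧ x = Multiplicative.ofAdd (c * k)}
  let T : Set Z := {x | ∃ k : ℤ, k < 0 ∧ x = Multiplicative.ofAdd (c * k)}
  have hST : Disjoint S T := by
    rw [Set.disjoint_left]
    rintro _ ⟨k, hk, rfl⟩ ⟨l, hl, h⟩
    have : c * k = c * l := h
    have := mul_left_cancel₀ hc this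
    omega
  let s : Q ≀ᵣ Z := inl (Multiplicative.ofAdd 1)
  have hs : s ^ c = inl (Multiplicative.ofAdd c) := by
    rw [← map_zpow, ← ofAdd_zsmul]
    simp
  have hcomm (v : Q ≀ᵣ Z) (hv : v.right = 1) (x : Z) :
      ⁅s ^ c, v⁆.left x = v.left (Multiplicative.ofAdd (x.toAdd - c)) * (v.left x)⁻¹ := by
    have : (Multiplicative.ofAdd c)⁻¹ * x = Multiplicative.ofAdd (x.toAdd - c) := by
      rw [mul_comm]; rfl
    simp [commutatorElement_def, hs, hv, this]
  have hcomm_right (v : Q ≀ᵣ Z) (hv : v.right = 1) : ⁅s ^ c, v⁆.right = 1 := by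
    simp [commutatorElement_def, hs, hv]
  have hS (x : ℤ) : Multiplicative.ofAdd (x - c) ∈ S ∨ x = 0 ↔ Multiplicative.ofAdd x ∈ S := by
    constructor
    · rintro (⟨k, hk, h⟩ | rfl)
      · have h : x - c = c * k := h
        exact ⟨k + 1, by omega, congrArg Multiplicative.ofAdd (by linear_combination h)⟩
      · exact ⟨0, le_rfl, by simp⟩
    · rintro ⟨k, hk, h⟩
      have h : x = c * k := h
      rcases hk.eq_or_lt with rfl | hk
      · exact Or.inr (by simpa using h)
      · exact Or.inl ⟨k - 1, by omega, congrArg Multiplicative.ofAdd (by linear_combination h)⟩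
  have hT (x : ℤ) : Multiplicative.ofAdd (x - c) ∈ T ↔ Multiplicative.ofAdd x ∈ T ∨ x = 0 := by
    constructor
    · rintro ⟨k, hk, h⟩
      have h : x - c = c * k := h
      rcases (show k + 1 ≤ 0 by omega).eq_or_lt with hk | hk
      · exact Or.inr (by linear_combination h + c * hk)
      · exact Or.inl ⟨k + 1, hk, congrArg Multiplicative.ofAdd (by linear_combination h)⟩
    · rintro (⟨k, hk, h⟩ | rfl)
      · have h : x = c * k := h
        exact ⟨k - 1, by omega, congrArg Multiplicative.ofAdd (by linear_combination h)⟩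
      · exact ⟨-1, by omega, by simp⟩
  have hS0 : Multiplicative.ofAdd (0 - c) ∉ S := by
    rintro ⟨k, hk, h⟩
    have h : 0 - c = c * k := h
    have := mul_left_cancel₀ hc (show c * (k + 1) = c * 0 by linear_combination -h)
    omega
  have hT0 : Multiplicative.ofAdd (0 : ℤ) ∉ T := by
    rintro ⟨k, hk, h⟩
    have h : 0 = c * k := h
    have := mul_left_cancel₀ hc (show c * k = c * 0 by linear_combination -h)
    omega
  refine ⟨Q ≀ᵣ Z, inferInstance, baseSingle 1, s, baseIndicator S, baseIndicator T,
    baseSingle_injective 1, fun q => ?_, fun q => ?_, fun q q' => commute_baseIndicator hST q q'⟩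
  · ext x
    · rw [hcomm _ rfl, baseIndicator_left, baseIndicator_left, baseSingle_left]
      have := hS x.toAdd
      by_cases hx : x.toAdd = 0
      · obtain rfl : x = 1 := hx
        have : (1 : Z) ∈ S := (hS 0).1 (Or.inr rfl)
        have h0 : Multiplicative.ofAdd ((1 : Z).toAdd - c) ∉ S := hS0
        rw [if_neg h0, if_pos this, one_mul, inv_inv, Pi.mulSingle_eq_same]
      · rw [Pi.mulSingle_eq_of_ne (show x ≠ 1 from hx)]
        simp only [hx, or_false, ofAdd_toAdd] at this
        simp only [this, mul_inv_cancel]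
    · exact hcomm_right _ rfl
  · ext x
    · rw [hcomm _ rfl, baseIndicator_left, baseIndicator_left, baseSingle_left]
      have := hT x.toAdd
      by_cases hx : x.toAdd = 0
      · obtain rfl : x = 1 := hx
        have h1 : (1 : Z) ∉ T := hT0
        have h0 : Multiplicative.ofAdd ((1 : Z).toAdd - c) ∈ T := (hT 0).2 (Or.inr rfl)
        rw [if_pos h0, if_neg h1, inv_one, mul_one, Pi.mulSingle_eq_same]
      · rw [Pi.mulSingle_eq_of_ne (show x ≠ 1 from hx)]
        simp only [hx, or_false, ofAdd_toAdd] at this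
        simp only [this, mul_inv_cancel]
    · exact hcomm_right _ rfl

/-- Every group embeds in a group in which all its elements have `c`-th roots. -/
theorem exists_root_extension (Q : Type u) [Group Q] {c : ℤ} (hc : c ≠ 0) :
    ∃ (G : Type u) (_ : Group G) (j : Q →* G) (ρ : Q → G), Function.Injective j ∧
      ∀ q, ρ q ^ c = j q := by
  classical
  suffices h : ∀ n : ℕ, n ≠ 0 → ∃ (G : Type u) (_ : Group G) (j : Q →* G) (ρ : Q → G),
      Function.Injective j ∧ ∀ q, ρ q ^ n = j q by
    obtain ⟨G, _, j, ρ, hj, hρ⟩ := h c.natAbs (Int.natAbs_ne_zero.2 hc)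
    rcases Int.natAbs_eq c with h | h
    · exact ⟨G, _, j, ρ, hj, fun q => by rw [h, zpow_natCast, hρ]⟩
    · exact ⟨G, _, j, fun q => (ρ q)⁻¹, hj, fun q => by
        rw [h, inv_zpow', neg_neg, zpow_natCast, hρ]⟩
  intro n hn
  have : NeZero n := ⟨hn⟩
  let Z := Multiplicative (ZMod n)
  let ρ (q : Q) : Q ≀ᵣ Z := ⟨Pi.mulSingle 1 q, Multiplicative.ofAdd 1⟩
  have hpow (q : Q) (i : ℕ) (hi : i ≤ n) :
      ρ q ^ i = ⟨fun x => if x.toAdd.val < i then q else 1, Multiplicative.ofAdd (i : ZMod n)⟩ := by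
    induction i with
    | zero => ext <;> simp
    | succ i ih =>
      rw [pow_succ, ih (by omega)]
      ext x
      · have hval : (Multiplicative.ofAdd (i : ZMod n))⁻¹ * x = 1 ↔ x.toAdd.val = i := by
          rw [inv_mul_eq_one]
          constructor
          · rintro rfl
            exact ZMod.val_cast_of_lt (by omega)
          · intro h
            rw [← h]
            simp
        simp only [mul_left, Pi.mul_apply, ρ, Pi.mulSingle_apply, hval]
        split_ifs <;> first | omega | simp
      · simp only [mul_right, ρ, Nat.cast_succ]
        rfl
  refine ⟨Q ≀ᵣ Z, inferInstance, baseIndicator Set.univ, ρ, ?_, fun q => ?_⟩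
  · intro b c h
    simpa [baseIndicator_left] using congrArg (fun g => g.left 1) h
  · rw [hpow q n le_rfl]
    ext x
    · simp [baseIndicator_left, ZMod.val_lt]
    · simp

theorem exists_commutator_powers_extension (Q : Type u) [Group Q] {c₁ c₂ : ℤ} (h₁ : c₁ ≠ 0)
    (h₂ : c₂ ≠ 0) (q q' : Q) :
    ∃ (G : Type u) (_ : Group G) (j : Q →* G) (s r r' : G), Function.Injective j ∧
      ⁅s ^ c₁, r ^ c₂⁆ = j q ∧ ⁅s ^ c₁, r' ^ c₂⁆ = j q' ∧ Commute r r' := by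
  obtain ⟨Q', _, i, ρ, hi, hρ⟩ := exists_root_extension Q h₂
  obtain ⟨G, _, j, s, r, r', hj, hr, hr', hcomm⟩ := exists_commutator_extension Q' h₁
  refine ⟨G, _, j.comp i, s, r (ρ q)⁻¹, r' (ρ q'), hj.comp hi, ?_, ?_, hcomm _ _⟩
  · rw [← map_zpow, inv_zpow, hρ, hr]
    rfl
  · rw [← map_zpow, hρ, hr']
    rfl

/-- Over every group, arbitrary sequences are simultaneously of the form
`⁅x, y ^ m * x * y ^ (-m)⁆`, where `m` ranges over the odd numbers. -/
theorem exists_commutator_conj_extension (Q : Type u) [Group Q] (q : ℕ → Q) :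
    ∃ (G : Type u) (_ : Group G) (j : Q →* G) (x y : G), Function.Injective j ∧
      ∀ i, ⁅x, y ^ (2 * i + 1) * x * (y ^ (2 * i + 1))⁻¹⁆ = j (q i) := by
  classical
  obtain ⟨G, _, j, s, -, r, hj, -, hr, -⟩ := exists_commutator_extension Q one_ne_zero
  simp only [zpow_one] at hr
  let Z := Multiplicative ℤ
  let b : Z → G := fun p => if p.toAdd = 0 then s else
    if ∃ i : ℕ, p.toAdd = -(2 * i + 1) then r (q ((-p.toAdd - 1) / 2).toNat) else 1
  let x : G ≀ᵣ Z := ⟨b, 1⟩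
  let y : G ≀ᵣ Z := inl (Multiplicative.ofAdd 1)
  have hb0 : b 1 = s := if_pos rfl
  have hb (i : ℕ) : b (Multiplicative.ofAdd (-(2 * i + 1))) = r (q i) := by
    have h1 : (-(2 * (i : ℤ) + 1)) ≠ 0 := by omega
    have h2 : ((- -(2 * (i : ℤ) + 1) - 1) / 2).toNat = i := by omega
    simp only [b, toAdd_ofAdd, if_neg h1, h2]
    exact if_pos ⟨i, rfl⟩
  have hb1 (p : Z) (h0 : p.toAdd ≠ 0) (h : ∀ i : ℕ, p.toAdd ≠ -(2 * i + 1)) : b p = 1 := by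
    simp only [b, if_neg h0, if_neg (not_exists.2 h)]
  refine ⟨G ≀ᵣ Z, inferInstance, (baseSingle 1).comp j, x, y,
    (baseSingle_injective 1).comp hj, fun i => ?_⟩
  have hy : (y ^ (2 * i + 1)) = inl (Multiplicative.ofAdd (2 * i + 1 : ℤ)) := by
    rw [← map_pow, ← ofAdd_nsmul]
    simp
  have hconj : (y ^ (2 * i + 1) * x * (y ^ (2 * i + 1))⁻¹).right = 1 := by simp [hy, x]
  ext p
  · rw [commutator_left _ _ rfl hconj, conj_left _ _ rfl, hy, MonoidHom.comp_apply,
      baseSingle_left]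
    have hp : (Multiplicative.ofAdd (2 * i + 1 : ℤ))⁻¹ * p =
        Multiplicative.ofAdd (p.toAdd - (2 * i + 1)) := by rw [mul_comm]; rfl
    simp only [left_inl, right_inl, Pi.one_apply, one_mul, inv_one, mul_one, hp, x]
    by_cases h0 : p.toAdd = 0
    · obtain rfl : p = 1 := h0
      have := hb i
      rw [show (-(2 * (i : ℤ) + 1)) = (1 : Z).toAdd - (2 * i + 1) by simp] at this
      rw [this, hb0, hr, Pi.mulSingle_eq_same]
    · rw [Pi.mulSingle_eq_of_ne (show p ≠ 1 from h0)]
      by_cases h : ∃ k : ℕ, p.toAdd = -(2 * k + 1)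
      · obtain ⟨k, hk⟩ := h
        rw [hb1 (Multiplicative.ofAdd _) (by rw [toAdd_ofAdd]; omega)
          (fun l => by rw [toAdd_ofAdd]; omega), commutatorElement_one_right]
      · rw [hb1 p h0 (not_exists.1 h), commutatorElement_one_left]
  · exact commutator_right _ _ rfl hconj

theorem UniversallySolvable.commutator_conj {F : Type*} [Group F] {w : Bool → F}
    (hw : UniversallySolvable.{u} w) (n : ℕ) :
    UniversallySolvable.{u} fun i : Fin n =>
      ⁅w true, w false ^ (2 * i.val + 1) * w true * (w false ^ (2 * i.val + 1))⁻¹⁆ := by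
  intro Q _ q
  obtain ⟨G, _, j, x, y, hj, hxy⟩ := exists_commutator_conj_extension Q
    fun i => if h : i < n then q ⟨i, h⟩ else 1
  obtain ⟨G', _, j', φ, hj', hφ⟩ := hw G fun b => if b then x else y
  refine ⟨G', _, j'.comp j, φ, hj'.comp hj, fun i => ?_⟩
  have := hxy i
  simp only [i.isLt, dif_pos] at this
  simp only [map_commutatorElement, map_mul, map_pow, map_inv, hφ, MonoidHom.comp_apply, ← this,
    if_true, Bool.false_eq_true, if_false]

section LabelHom

variable {α B P : Type*} [Group B] [Group P] [DecidableEq α]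

/-- The hom that keeps track, along a path in the Cayley graph of `P`, of the product of the labels
of the traversed `k`-edges, where the edge from `p` to `(φ k)⁻¹ * p` is labelled by `b p`. -/
def labelHom (φ : FreeGroup α →* P) (k : α) (b : P → B) : FreeGroup α →* B ≀ᵣ P :=
  FreeGroup.lift fun l => ⟨if l = k then b else 1, φ (FreeGroup.of l)⟩

/-- The sources, relative to the starting point, of the edges traversed by a word. -/
def edgePositions (φ : FreeGroup α →* P) : List (α × Bool) → List P
  | [] => []
  | (l, true) :: L => 1 :: (edgePositions φ L).map (· * (φ (FreeGroup.of l))⁻¹)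
  | (l, false) :: L => φ (FreeGroup.of l) :: (edgePositions φ L).map (· * φ (FreeGroup.of l))

variable (φ : FreeGroup α →* P) (k : α) (b : P → B)

@[simp]
theorem labelHom_right (w : FreeGroup α) : (labelHom φ k b w).right = φ w := by
  have : rightHom.comp (labelHom φ k b) = φ := by
    ext l
    simp [labelHom, rightHom]
  exact DFunLike.congr_fun this w

theorem labelHom_mul_left (v w : FreeGroup α) (x : P) :
    (labelHom φ k b (v * w)).left x =
      (labelHom φ k b v).left x * (labelHom φ k b w).left ((φ v)⁻¹ * x) := by
  simp

theorem labelHom_cons_true_left (l : α) (L : List (α × Bool)) (x : P) :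
    (labelHom φ k b (FreeGroup.mk ((l, true) :: L))).left x =
      (if l = k then b x else 1) *
        (labelHom φ k b (FreeGroup.mk L)).left ((φ (FreeGroup.of l))⁻¹ * x) := by
  rw [show FreeGroup.mk ((l, true) :: L) = FreeGroup.of l * FreeGroup.mk L from rfl,
    labelHom_mul_left]
  congr 1
  simp only [labelHom, FreeGroup.lift_apply_of]
  split_ifs <;> rfl

theorem labelHom_cons_false_left (l : α) (L : List (α × Bool)) (x : P) :
    (labelHom φ k b (FreeGroup.mk ((l, false) :: L))).left x =
      (if l = k then (b (φ (FreeGroup.of l) * x))⁻¹ else 1) *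
        (labelHom φ k b (FreeGroup.mk L)).left (φ (FreeGroup.of l) * x) := by
  rw [show FreeGroup.mk ((l, false) :: L) = (FreeGroup.of l)⁻¹ * FreeGroup.mk L from rfl,
    labelHom_mul_left, map_inv φ, inv_inv]
  congr 1
  simp only [labelHom, map_inv, FreeGroup.lift_apply_of]
  split_ifs <;> simp

theorem labelHom_mk_left_mem (L : List (α × Bool)) (K : Subgroup B) (x : P)
    (h : ∀ s ∈ edgePositions φ L, b (s * x) ∈ K) :
    (labelHom φ k b (FreeGroup.mk L)).left x ∈ K := by
  induction L generalizing x with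
  | nil => simp [← FreeGroup.one_eq_mk]
  | cons a L ih =>
    obtain ⟨l, _ | _⟩ := a <;> simp only [edgePositions, List.forall_mem_cons,
      List.forall_mem_map, one_mul] at h
    · rw [labelHom_cons_false_left]
      refine K.mul_mem ?_ (ih _ fun s hs => ?_)
      · split_ifs
        exacts [K.inv_mem h.1, K.one_mem]
      · rw [← mul_assoc]
        exact h.2 s hs
    · rw [labelHom_cons_true_left]
      refine K.mul_mem ?_ (ih _ fun s hs => ?_)
      · split_ifs
        exacts [h.1, K.one_mem]
      · rw [← mul_assoc]
        exact h.2 s hs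

theorem labelHom_mk_left_congr {b b' : P → B} (L : List (α × Bool)) (x : P)
    (h : ∀ s ∈ edgePositions φ L, b (s * x) = b' (s * x)) :
    (labelHom φ k b (FreeGroup.mk L)).left x = (labelHom φ k b' (FreeGroup.mk L)).left x := by
  induction L generalizing x with
  | nil => simp [← FreeGroup.one_eq_mk]
  | cons a L ih =>
    obtain ⟨l, _ | _⟩ := a <;> simp only [edgePositions, List.forall_mem_cons,
      List.forall_mem_map, one_mul] at h
    · rw [labelHom_cons_false_left, labelHom_cons_false_left, h.1,
        ih _ fun s hs => by rw [← mul_assoc]; exact h.2 s hs]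
    · rw [labelHom_cons_true_left, labelHom_cons_true_left, h.1,
        ih _ fun s hs => by rw [← mul_assoc]; exact h.2 s hs]

theorem labelHom_comp_translate_left {C : Type*} [Group C] (f : B →* C) (g : P) (w : FreeGroup α)
    (x : P) : (labelHom φ k (fun y => f (b (y * g))) w).left x =
      f ((labelHom φ k b w).left (x * g)) := by
  obtain ⟨L, rfl⟩ := Quot.exists_rep w
  change (labelHom φ k _ (FreeGroup.mk L)).left x = f ((labelHom φ k b (FreeGroup.mk L)).left _)
  induction L generalizing x with
  | nil => simp [← FreeGroup.one_eq_mk]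
  | cons a L ih =>
    obtain ⟨l, _ | _⟩ := a
    · rw [labelHom_cons_false_left, labelHom_cons_false_left, ih, map_mul, mul_assoc]
      split_ifs <;> simp
    · rw [labelHom_cons_true_left, labelHom_cons_true_left, ih, map_mul, mul_assoc]
      split_ifs <;> simp

theorem labelHom_pow_left_mem {d : FreeGroup α} (K : Subgroup B) (m : ℕ) (x : P)
    (h : ∀ l < m, ∀ s ∈ edgePositions φ d.toWord, b (s * ((φ d ^ l)⁻¹ * x)) ∈ K) :
    (labelHom φ k b (d ^ m)).left x ∈ K := by
  induction m with
  | zero => simp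
  | succ m ih =>
    rw [pow_succ, labelHom_mul_left, map_pow φ]
    refine K.mul_mem (ih fun l hl => h l (by omega)) ?_
    have := labelHom_mk_left_mem φ k b d.toWord K _ (h m (by omega))
    rwa [FreeGroup.mk_toWord] at this

variable [DecidableEq P]

/-- The algebraic number of times the path of `w` starting at `x` traverses the `k`-edge
at `1`. -/
def edgeCount (w : FreeGroup α) (x : P) : ℤ :=
  ((labelHom φ k (Pi.mulSingle 1 (Multiplicative.ofAdd (1 : ℤ))) w).left x).toAdd

theorem labelHom_mulSingle_left (g : P) (r : B) (w : FreeGroup α) (x : P) :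
    (labelHom φ k (Pi.mulSingle g r) w).left x = r ^ edgeCount φ k w (x * g⁻¹) := by
  have := labelHom_comp_translate_left φ k (Pi.mulSingle 1 (Multiplicative.ofAdd (1 : ℤ)))
    (zpowersHom B r) g⁻¹ w x
  rw [zpowersHom_apply] at this
  rw [edgeCount, ← this]
  congr! 3
  ext y
  by_cases hy : y = g
  · subst hy
    simp
  · rw [Pi.mulSingle_eq_of_ne hy, Pi.mulSingle_eq_of_ne (by simpa [mul_inv_eq_one] using hy),
      map_one]

theorem exists_edgePositions_of_edgeCount_ne_zero {L : List (α × Bool)} {x : P}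
    (h : edgeCount φ k (FreeGroup.mk L) x ≠ 0) : ∃ s ∈ edgePositions φ L, s * x = 1 := by
  by_contra! hs
  refine h (congrArg Multiplicative.toAdd (Subgroup.mem_bot.1
    (labelHom_mk_left_mem φ k _ L ⊥ x fun s hsL => ?_)))
  rw [Pi.mulSingle_eq_of_ne (hs s hsL)]
  exact Subgroup.one_mem _

end LabelHom

section OrderedQuotient

variable {α B P : Type*} [Group B] [Group P] [LinearOrder P] [MulLeftMono P] [MulRightMono P]
  [DecidableEq α]

theorem exists_labelHom_commutator_eq_baseSingle (φ : FreeGroup α →* P) (k : α)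
    {u d : FreeGroup α} (hu : φ u = 1) {S : Set P} (hSu : ∀ s ∈ edgePositions φ u.toWord, s ∈ S)
    (hSd : ∀ s ∈ edgePositions φ d.toWord, s ∈ S) {a₁ a₂ : P} (h₁ : edgeCount φ k u a₁ ≠ 0)
    (hmax : ∀ x, edgeCount φ k u x ≠ 0 → x ≤ a₁) (hmin : ∀ x, edgeCount φ k u x ≠ 0 → a₂ ≤ x)
    (m : Bool → ℕ) {l₀ : ℕ} (hm : ∀ i, l₀ ≤ m i) {g : Bool → P}
    (hg : ∀ i, g i = a₂⁻¹ * (φ d ^ m i)⁻¹ * a₁)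
    (ha : ∀ l ≥ l₀, ∀ s ∈ S, ∀ t ∈ S, s * ((φ d ^ l)⁻¹ * t⁻¹) ≠ 1)
    (hb : ∀ i, ∀ l ≤ l₀, ∀ s ∈ S, ∀ t ∈ S, s * ((φ d ^ l)⁻¹ * t⁻¹) ≠ g i)
    (hc : ∀ i l, ∀ s ∈ S, ∀ t ∈ S, s * ((φ d ^ l)⁻¹ * (t⁻¹ * g i)) ≠ 1)
    (hd : ∀ i j, i ≠ j → ∀ s ∈ S, ∀ t ∈ S, s * ((φ d ^ m i)⁻¹ * t⁻¹) ≠ g j)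
    (hg1 : ∀ i, g i ≠ 1) (hgg : g true ≠ g false)
    (s : B) (r : Bool → B) (hr : Commute (r true) (r false)) :
    ∃ (b : P → B) (y : B), ∀ i, labelHom φ k b ⁅u, d ^ m i * u * (d ^ m i)⁻¹⁆ =
      baseSingle a₁ (y * ⁅s ^ edgeCount φ k u a₁, r i ^ edgeCount φ k u a₂⁆ * y⁻¹) := by
  let b : P → B := fun p => if p = 1 then s else if p = g true then r true else
    if p = g false then r false else 1
  have hb1 : b 1 = s := if_pos rfl
  have hbg (i : Bool) : b (g i) = r i := by
    cases i
    · simp only [b, if_neg (hg1 _), if_neg hgg.symm, if_true]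
    · simp only [b, if_neg (hg1 _), if_true]
  have hb0 (p : P) (h1 : p ≠ 1) (h : ∀ i, p ≠ g i) : b p = 1 := by
    simp only [b, if_neg h1, if_neg (h _)]
  let T : Subgroup B := Subgroup.closure (Set.range r)
  have hT (x y : B) (hx : x ∈ T) (hy : y ∈ T) : Commute x y := by
    refine Subgroup.closure_induction₂ (p := fun x y _ _ => Commute x y) ?_ (fun _ _ => .one_left _)
      (fun _ _ => .one_right _) (fun _ _ _ _ _ _ h h' => h.mul_left h')
      (fun _ _ _ _ _ _ h h' => h.mul_right h') (fun _ _ _ _ h => h.inv_left)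
      (fun _ _ _ _ h => h.inv_right) hx hy
    rintro _ _ ⟨i, rfl⟩ ⟨j, rfl⟩
    cases i <;> cases j
    exacts [.refl _, hr.symm, hr, .refl _]
  have hrT (i : Bool) : r i ∈ T := Subgroup.subset_closure ⟨i, rfl⟩
  have hbT (p : P) (hp : p ≠ 1) : b p ∈ T := by
    by_cases h : ∃ i, p = g i
    · obtain ⟨i, rfl⟩ := h
      rw [hbg]
      exact hrT i
    · rw [hb0 p hp (not_exists.1 h)]
      exact T.one_mem
  have hbs (p : P) (hp : ∀ i, p ≠ g i) : b p = Pi.mulSingle (M := fun _ => B) 1 s p := by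
    by_cases h : p = 1
    · rw [h, hb1, Pi.mulSingle_eq_same]
    · rw [hb0 p h hp, Pi.mulSingle_eq_of_ne h]
  have hbr (i : Bool) (p : P) (hp : p ≠ 1) (hi : ∀ j, i ≠ j → p ≠ g j) :
      b p = Pi.mulSingle (M := fun _ => B) (g i) (r i) p := by
    by_cases h : p = g i
    · rw [h, hbg, Pi.mulSingle_eq_same]
    · rw [Pi.mulSingle_eq_of_ne h]
      refine hb0 p hp fun j => ?_
      by_cases hij : i = j
      exacts [hij ▸ h, hi j hij]
  have hU {b' : P → B} {x : P} (h : ∀ t ∈ S, b (t * x) = b' (t * x)) :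
      (labelHom φ k b u).left x = (labelHom φ k b' u).left x := by
    have := labelHom_mk_left_congr φ k u.toWord x fun t ht => h t (hSu t ht)
    rwa [FreeGroup.mk_toWord] at this
  have hUT {x : P} (h : ∀ t ∈ S, t * x ≠ 1) : (labelHom φ k b u).left x ∈ T := by
    have := labelHom_mk_left_mem φ k b u.toWord T x fun t ht => hbT _ (h t (hSu t ht))
    rwa [FreeGroup.mk_toWord] at this
  have hDT {n : ℕ} {x : P} (h : ∀ l < n, ∀ t ∈ S, t * ((φ d ^ l)⁻¹ * x) ≠ 1) :
      (labelHom φ k b (d ^ n)).left x ∈ T :=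
    labelHom_pow_left_mem φ k b T n x fun l hl t ht => hbT _ (h l hl t (hSd t ht))
  have hcS {x : P} (hx : edgeCount φ k u x ≠ 0) : ∃ t ∈ S, x = t⁻¹ := by
    rw [← FreeGroup.mk_toWord (x := u)] at hx
    obtain ⟨t, ht, h⟩ := exists_edgePositions_of_edgeCount_ne_zero φ k hx
    exact ⟨t, hSu t ht, (inv_eq_of_mul_eq_one_right h).symm⟩
  have huright : (labelHom φ k b u).right = 1 := by rw [labelHom_right, hu]
  refine ⟨b, (labelHom φ k b (d ^ l₀)).left a₁, fun i => ?_⟩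
  have hvright : (labelHom φ k b (d ^ m i * u * (d ^ m i)⁻¹)).right = 1 := by
    simp [hu]
  have hleft (x : P) : (labelHom φ k b ⁅u, d ^ m i * u * (d ^ m i)⁻¹⁆).left x =
      ⁅(labelHom φ k b u).left x, (labelHom φ k b (d ^ m i)).left x *
        (labelHom φ k b u).left ((φ d ^ m i)⁻¹ * x) * ((labelHom φ k b (d ^ m i)).left x)⁻¹⁆ := by
    rw [map_commutatorElement, commutator_left _ _ huright hvright, map_mul, map_mul, map_inv,
      conj_left _ _ huright, labelHom_right, map_pow φ]
  have hnear (t : P) (ht : t ∈ S) :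
      (labelHom φ k b ⁅u, d ^ m i * u * (d ^ m i)⁻¹⁆).left t⁻¹ =
        (labelHom φ k b (d ^ l₀)).left t⁻¹ * ⁅s ^ edgeCount φ k u t⁻¹,
          r i ^ edgeCount φ k u ((φ d ^ m i)⁻¹ * t⁻¹ * (g i)⁻¹)⁆ *
          ((labelHom φ k b (d ^ l₀)).left t⁻¹)⁻¹ := by
    obtain ⟨n, hn⟩ := Nat.exists_eq_add_of_le (hm i)
    have hU1 : (labelHom φ k b u).left t⁻¹ = s ^ edgeCount φ k u t⁻¹ := by
      rw [hU fun p hp => hbs _ fun j => by simpa using hb j 0 (Nat.zero_le _) p hp t ht,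
        labelHom_mulSingle_left, inv_one, mul_one]
    have hU2 : (labelHom φ k b u).left ((φ d ^ m i)⁻¹ * t⁻¹) =
        r i ^ edgeCount φ k u ((φ d ^ m i)⁻¹ * t⁻¹ * (g i)⁻¹) := by
      rw [hU fun p hp => hbr i _ (ha _ (hm i) p hp t ht) fun j hij => hd i j hij p hp t ht,
        labelHom_mulSingle_left]
    have hy : (labelHom φ k b (d ^ l₀)).left t⁻¹ ∈ Subgroup.zpowers s := by
      refine labelHom_pow_left_mem φ k b _ l₀ _ fun l hl p hp => ?_
      rw [hbs _ fun j => hb j l hl.le p (hSd p hp) t ht, Pi.mulSingle_apply]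
      split_ifs
      exacts [Subgroup.mem_zpowers s, Subgroup.one_mem _]
    have hz : (labelHom φ k b (d ^ n)).left ((φ d ^ l₀)⁻¹ * t⁻¹) ∈ T := by
      refine hDT fun l _ p hp => ?_
      have := ha (l₀ + l) (Nat.le_add_right _ _) p hp t ht
      rwa [pow_add, mul_inv_rev, mul_assoc _ _ t⁻¹] at this
    rw [hleft, hU1, hU2, hn, pow_add, labelHom_mul_left, map_pow φ, ← hn]
    set y := (labelHom φ k b (d ^ l₀)).left t⁻¹
    set z := (labelHom φ k b (d ^ n)).left ((φ d ^ l₀)⁻¹ * t⁻¹)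
    have hzr := hT z _ hz (T.zpow_mem (hrT i) (edgeCount φ k u ((φ d ^ m i)⁻¹ * t⁻¹ * (g i)⁻¹)))
    have hys : Commute y (s ^ edgeCount φ k u t⁻¹) := by
      obtain ⟨e, he⟩ := hy
      rw [← he]
      exact (Commute.refl s).zpow_zpow e _
    have hys' : s ^ edgeCount φ k u t⁻¹ = y * s ^ edgeCount φ k u t⁻¹ * y⁻¹ := by
      rw [hys.eq, mul_inv_cancel_right]
    rw [mul_inv_rev, mul_assoc y z, hzr.eq, ← mul_assoc, ← mul_assoc, mul_inv_cancel_right,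
      conjugate_commutatorElement, ← hys']
  ext x
  · rw [baseSingle_left]
    by_cases hx : ∃ t ∈ S, x = t⁻¹
    · obtain ⟨t, ht, rfl⟩ := hx
      rw [hnear t ht]
      by_cases hxa : t⁻¹ = a₁
      · rw [hxa, Pi.mulSingle_eq_same, hg]
        congr! 5
        group
      · rw [Pi.mulSingle_eq_of_ne hxa]
        by_cases h1 : edgeCount φ k u t⁻¹ = 0
        · rw [h1]
          simp
        by_cases h2 : edgeCount φ k u ((φ d ^ m i)⁻¹ * t⁻¹ * (g i)⁻¹) = 0
        · rw [h2]
          simp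
        refine absurd (le_antisymm (hmax _ h1) ?_) hxa
        have := hmin _ h2
        rw [hg, show (φ d ^ m i)⁻¹ * t⁻¹ * (a₂⁻¹ * (φ d ^ m i)⁻¹ * a₁)⁻¹ =
          ((φ d ^ m i)⁻¹ * (t⁻¹ * a₁⁻¹) * (φ d ^ m i)) * a₂ by group,
          le_mul_iff_one_le_left'] at this
        have h := mul_le_mul_left (mul_le_mul_right this (φ d ^ m i)) (φ d ^ m i)⁻¹
        have : 1 ≤ t⁻¹ * a₁⁻¹ := by
          convert h using 1 <;> group
        simpa using mul_le_mul_left this a₁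
    · have hxa : x ≠ a₁ := by
        rintro rfl
        exact hx (hcS h₁)
      have hx1 (t : P) (ht : t ∈ S) : t * x ≠ 1 := fun h =>
        hx ⟨t, ht, (inv_eq_of_mul_eq_one_right h).symm⟩
      rw [Pi.mulSingle_eq_of_ne hxa, hleft]
      by_cases h : ∃ j, ∃ t ∈ S, t * x = g j
      · obtain ⟨j, t, ht, h⟩ := h
        obtain rfl : x = t⁻¹ * g j := by rw [← h, inv_mul_cancel_left]
        refine commutatorElement_eq_one_iff_commute.2 (hT _ _ (hUT hx1) ?_)
        have hD := hDT (n := m i) fun l _ p hp => hc j l p hp t ht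
        exact T.mul_mem (T.mul_mem hD (hUT fun p hp => hc j _ p hp t ht)) (T.inv_mem hD)
      · push Not at h
        rw [hU (b' := Pi.mulSingle 1 1) fun t ht => by
          rw [hb0 _ (hx1 t ht) fun j => h j t ht, Pi.mulSingle_one, Pi.one_apply],
          labelHom_mulSingle_left, one_zpow, commutatorElement_one_left]
  · rw [map_commutatorElement, commutator_right _ _ huright hvright, baseSingle_right]

end OrderedQuotient

section OrderedGroup

variable {P : Type u} [Group P] [LinearOrder P] [MulLeftMono P]

theorem eventually_pow_ne {δ : P} (hδ : 1 < δ) (z : P) : ∀ᶠ m in atTop, δ ^ m ≠ z := by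
  by_cases h : ∃ n, δ ^ n = z
  · obtain ⟨n, rfl⟩ := h
    filter_upwards [eventually_gt_atTop n] with m hm
    exact (pow_right_strictMono' hδ hm).ne'
  · exact Eventually.of_forall (not_exists.1 h)

variable [MulRightMono P]

theorem eventually_forall_pow_ne_mul_inv_pow_mul {δ : P} (hδ : 1 < δ) (z z' : P) :
    ∀ᶠ m in atTop, ∀ l : ℕ, δ ^ l ≠ z * (δ ^ m)⁻¹ * z' := by
  by_cases h : ∃ n l, δ ^ l = z * (δ ^ n)⁻¹ * z'
  · obtain ⟨n, l₁, h⟩ := h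
    have hfin := (eventually_all_finite (Set.finite_lt_nat l₁)).2 fun l _ =>
      eventually_pow_ne hδ (z' * (δ ^ l)⁻¹ * z)
    filter_upwards [eventually_gt_atTop n, hfin] with m hm hne l hl
    have hlt : z * (δ ^ m)⁻¹ * z' < z * (δ ^ n)⁻¹ * z' :=
      mul_lt_mul_left (mul_lt_mul_right (inv_lt_inv_iff.2 (pow_right_strictMono' hδ hm)) z) z'
    rw [← hl, ← h] at hlt
    refine hne l ((pow_right_strictMono' hδ).lt_iff_lt.1 hlt) ?_
    rw [hl]
    group
  · push Not at h
    exact Eventually.of_forall h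

variable {α : Type*} [DecidableEq α]

/-- If `u` dies in a bi-ordered quotient while `d` becomes positive, and the relation module
class of `u` is nontrivial, then two commutators of `u` with conjugates of `u` by powers of `d`
form a universally solvable pair. -/
theorem exists_universallySolvable_commutators (φ : FreeGroup α →* P) (k : α) {u d : FreeGroup α}
    (hu : φ u = 1) (hd : 1 < φ d) (hcount : ∃ x, edgeCount φ k u x ≠ 0) :
    ∃ m : Bool → ℕ, UniversallySolvable.{u} fun i => ⁅u, d ^ m i * u * (d ^ m i)⁻¹⁆ := by
  set δ := φ d with hδ
  let S : Set P := {s | s ∈ edgePositions φ u.toWord ∨ s ∈ edgePositions φ d.toWord}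
  have hS : S.Finite := (List.finite_toSet _).union (List.finite_toSet _)
  have hcS {x : P} (hx : edgeCount φ k u x ≠ 0) : ∃ t ∈ S, t * x = 1 := by
    rw [← FreeGroup.mk_toWord (x := u)] at hx
    obtain ⟨t, ht, h⟩ := exists_edgePositions_of_edgeCount_ne_zero φ k hx
    exact ⟨t, Or.inl ht, h⟩
  have hsupp : {x | edgeCount φ k u x ≠ 0}.Finite := by
    refine (hS.image (·⁻¹)).subset fun x hx => ?_
    obtain ⟨t, ht, h⟩ := hcS hx
    exact ⟨t, ht, inv_eq_of_mul_eq_one_right h⟩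
  obtain ⟨a₁, h₁, hmax⟩ := hsupp.exists_maximalFor id _ hcount
  obtain ⟨a₂, h₂, hmin⟩ := hsupp.exists_minimalFor id _ hcount
  replace hmax (x : P) (hx : edgeCount φ k u x ≠ 0) : x ≤ a₁ :=
    (le_total a₁ x).elim (fun h => hmax hx h) id
  replace hmin (x : P) (hx : edgeCount φ k u x ≠ 0) : a₂ ≤ x :=
    (le_total x a₂).elim (fun h => hmin hx h) id
  obtain ⟨t₁, ht₁, hta₁⟩ := hcS h₁
  obtain ⟨t₂, ht₂, hta₂⟩ := hcS h₂
  obtain rfl : a₁ = t₁⁻¹ := (inv_eq_of_mul_eq_one_right hta₁).symm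
  obtain rfl : a₂ = t₂⁻¹ := (inv_eq_of_mul_eq_one_right hta₂).symm
  let g (m : ℕ) : P := t₂⁻¹⁻¹ * (δ ^ m)⁻¹ * t₁⁻¹
  have hall {p : P → P → ℕ → Prop} (h : ∀ s t, ∀ᶠ m in atTop, p s t m) :
      ∀ᶠ m in atTop, ∀ s ∈ S, ∀ t ∈ S, p s t m :=
    (eventually_all_finite hS).2 fun s _ => (eventually_all_finite hS).2 fun t _ => h s t
  have hne (z : P) : ∀ᶠ m in atTop, z ≠ g m := by
    filter_upwards [eventually_pow_ne hd (t₁⁻¹ * z⁻¹ * t₂)] with m hm h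
    refine hm ?_
    rw [h]
    simp only [g]
    group
  obtain ⟨l₀, ha⟩ := eventually_atTop.1 (hall (p := fun s t l => s * ((δ ^ l)⁻¹ * t⁻¹) ≠ 1)
    fun s t => by
      filter_upwards [eventually_pow_ne hd (t⁻¹ * s)] with m hm h
      refine hm ?_
      rw [mul_eq_one_iff_eq_inv] at h
      rw [h]
      group)
  have hb : ∀ᶠ m in atTop, ∀ l ≤ l₀, ∀ s ∈ S, ∀ t ∈ S, s * ((δ ^ l)⁻¹ * t⁻¹) ≠ g m :=
    (eventually_all_finite (Set.finite_le_nat l₀)).2 fun l _ => hall fun s t => hne _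
  have hc : ∀ᶠ m in atTop, ∀ s ∈ S, ∀ t ∈ S, ∀ l : ℕ, s * ((δ ^ l)⁻¹ * (t⁻¹ * g m)) ≠ 1 :=
    hall fun s t => by
      filter_upwards [eventually_forall_pow_ne_mul_inv_pow_mul hd (t⁻¹ * t₂) (t₁⁻¹ * s)]
        with m hm l h
      refine hm l ?_
      rw [mul_eq_one_iff_eq_inv] at h
      rw [h]
      simp only [g]
      group
  have hlarge := (eventually_ge_atTop l₀).and (hb.and hc)
  obtain ⟨m₁, hm₁⟩ := hlarge.exists
  have hd₁ := hall fun s t => hne (s * ((δ ^ m₁)⁻¹ * t⁻¹))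
  have hd₂ := hall (p := fun s t m => s * ((δ ^ m)⁻¹ * t⁻¹) ≠ g m₁) fun s t => by
    filter_upwards [eventually_pow_ne hd (t⁻¹ * (g m₁)⁻¹ * s)] with m hm h
    refine hm ?_
    rw [← h]
    group
  obtain ⟨m₂, hm₂, hd₁, hd₂⟩ := (hlarge.and (hd₁.and hd₂)).exists
  let m (i : Bool) : ℕ := if i then m₁ else m₂
  have hm : ∀ i, l₀ ≤ m i ∧ (∀ l ≤ l₀, ∀ s ∈ S, ∀ t ∈ S, s * ((δ ^ l)⁻¹ * t⁻¹) ≠ g (m i)) ∧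
      ∀ s ∈ S, ∀ t ∈ S, ∀ l : ℕ, s * ((δ ^ l)⁻¹ * (t⁻¹ * g (m i))) ≠ 1 :=
    Bool.forall_bool.2 ⟨hm₂, hm₁⟩
  have hd₃ (i j : Bool) (hij : i ≠ j) :
      ∀ s ∈ S, ∀ t ∈ S, s * ((δ ^ m i)⁻¹ * t⁻¹) ≠ g (m j) := by
    cases i <;> cases j
    exacts [absurd rfl hij, hd₂, hd₁, absurd rfl hij]
  have hg1 (i : Bool) : g (m i) ≠ 1 := by
    intro h
    have := (hm i).2.2 t₁ ht₁ t₁ ht₁ 0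
    simp [h] at this
  have hgg : g (m true) ≠ g (m false) := by
    have := hd₁ t₂ ht₂ t₁ ht₁
    simpa [g, m, mul_assoc] using this
  refine ⟨m, fun Q _ q => ?_⟩
  obtain ⟨G, _, j, s, r, r', hj, hr, hr', hcomm⟩ :=
    exists_commutator_powers_extension Q h₁ h₂ (q true) (q false)
  obtain ⟨b, y, hby⟩ := exists_labelHom_commutator_eq_baseSingle φ k hu (S := S)
    (fun _ => Or.inl) (fun _ => Or.inr) h₁ hmax hmin m (fun i => (hm i).1) (g := fun i => g (m i))
    (fun i => rfl) ha (fun i => (hm i).2.1) (fun i l s hs t ht => (hm i).2.2 s hs t ht l)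
    hd₃ hg1 hgg s (fun i => if i then r else r') hcomm
  refine ⟨G ≀ᵣ P, inferInstance, ((baseSingle t₁⁻¹).comp (MulAut.conj y).toMonoidHom).comp j,
    labelHom φ k b, ((baseSingle_injective _).comp (MulAut.conj y).injective).comp hj,
    fun i => ?_⟩
  rw [hby]
  cases i
  · simp only [Bool.false_eq_true, if_false, hr']
    rfl
  · simp only [if_true, hr]
    rfl

end OrderedGroup

/-- The semidirect product of the free `ℤ[P]`-module on `α` with `P`. -/
@[ext]
structure MagnusGroup (α P : Type*) where
  /-- The component in the free `ℤ[P]`-module on `α`. -/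
  left : Lex ((α ×ₗ P) →₀ ℤ)
  /-- The component in `P`. -/
  right : P

namespace MagnusGroup

variable {α P : Type*} [Group P]

/-- Left translation of the second coordinate. -/
def translate (α : Type*) (p : P) : (α ×ₗ P) ≃ (α ×ₗ P) :=
  ofLex.trans ((Equiv.prodCongr (Equiv.refl α) (Equiv.mulLeft p)).trans toLex)

/-- The action of `P` on the free `ℤ[P]`-module on `α`. -/
noncomputable def shift (p : P) (n : Lex ((α ×ₗ P) →₀ ℤ)) : Lex ((α ×ₗ P) →₀ ℤ) :=
  toLex ((ofLex n).equivMapDomain (translate α p))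

theorem translate_mul (p q : P) (x : α ×ₗ P) :
    translate α (p * q) x = translate α p (translate α q x) :=
  ofLex.injective (Prod.ext rfl (mul_assoc _ _ _))

theorem translate_symm (p : P) : (translate α p).symm = translate α p⁻¹ :=
  Equiv.ext fun _ => rfl

theorem shift_apply (p : P) (n : Lex ((α ×ₗ P) →₀ ℤ)) (x : α ×ₗ P) :
    ofLex (shift p n) x = ofLex n (translate α p⁻¹ x) := rfl

theorem shift_mul (p q : P) (n : Lex ((α ×ₗ P) →₀ ℤ)) :
    shift (p * q) n = shift p (shift q n) := by
  refine ofLex.injective (Finsupp.ext fun x => ?_)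
  simp only [shift_apply, mul_inv_rev, translate_mul]

theorem shift_one (n : Lex ((α ×ₗ P) →₀ ℤ)) : shift 1 n = n := by
  refine ofLex.injective (Finsupp.ext fun x => ?_)
  simp [shift_apply, translate]

theorem shift_add (p : P) (n n' : Lex ((α ×ₗ P) →₀ ℤ)) :
    shift p (n + n') = shift p n + shift p n' := by
  refine ofLex.injective (Finsupp.ext fun x => ?_)
  rfl

theorem shift_zero (p : P) : shift p (0 : Lex ((α ×ₗ P) →₀ ℤ)) = 0 := by
  refine ofLex.injective (Finsupp.ext fun x => ?_)
  rfl

noncomputable instance : Mul (MagnusGroup α P) where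
  mul a b := ⟨a.left + shift a.right b.left, a.right * b.right⟩

noncomputable instance : One (MagnusGroup α P) where
  one := ⟨0, 1⟩

noncomputable instance : Inv (MagnusGroup α P) where
  inv a := ⟨shift a.right⁻¹ (-a.left), a.right⁻¹⟩

@[simp]
theorem mul_left (a b : MagnusGroup α P) : (a * b).left = a.left + shift a.right b.left := rfl

@[simp]
theorem mul_right (a b : MagnusGroup α P) : (a * b).right = a.right * b.right := rfl

@[simp]
theorem one_left : (1 : MagnusGroup α P).left = 0 := rfl

@[simp]
theorem one_right : (1 : MagnusGroup α P).right = 1 := rfl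

@[simp]
theorem inv_left (a : MagnusGroup α P) : a⁻¹.left = shift a.right⁻¹ (-a.left) := rfl

@[simp]
theorem inv_right (a : MagnusGroup α P) : a⁻¹.right = a.right⁻¹ := rfl

noncomputable instance : Group (MagnusGroup α P) :=
  Group.ofLeftAxioms
    (fun a b c => by ext1 <;> simp [shift_add, shift_mul, add_assoc, mul_assoc])
    (fun a => by ext1 <;> simp [shift_one])
    (fun a => by ext1 <;> simp [← shift_add, shift_zero])

theorem commute_of_right_eq_one {a b : MagnusGroup α P} (ha : a.right = 1) (hb : b.right = 1) :
    Commute a b := by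
  ext1
  · simp [ha, hb, shift_one, add_comm]
  · simp [ha, hb]

/-- The coefficients of the basis element `k`. -/
def coeffHom (k : α) : MagnusGroup α P →* Multiplicative ℤ ≀ᵣ P where
  toFun a := ⟨fun x => Multiplicative.ofAdd (ofLex a.left (toLex (k, x))), a.right⟩
  map_one' := rfl
  map_mul' _ _ := rfl

theorem coeffHom_left (k : α) (a : MagnusGroup α P) (x : P) :
    (coeffHom k a).left x = Multiplicative.ofAdd (ofLex a.left (toLex (k, x))) := rfl

@[simp]
theorem coeffHom_right (k : α) (a : MagnusGroup α P) : (coeffHom k a).right = a.right := rfl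

section Order

variable {α P : Type*} [LinearOrder α] [LinearOrder P]

noncomputable instance : LinearOrder (MagnusGroup α P) :=
  LinearOrder.lift' (fun a => toLex (a.right, a.left)) fun a b h => by
    have := toLex.injective h
    ext1
    exacts [congrArg Prod.snd this, congrArg Prod.fst this]

theorem le_def {a b : MagnusGroup α P} :
    a ≤ b ↔ a.right < b.right ∨ a.right = b.right ∧ a.left ≤ b.left :=
  Prod.Lex.toLex_le_toLex

variable [Group P] [MulLeftMono P]

theorem translate_lt_translate (p : P) {x y : α ×ₗ P} (h : x < y) :
    translate α p x < translate α p y := by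
  rw [Prod.Lex.lt_iff] at h ⊢
  exact h.imp id fun h => ⟨h.1, mul_lt_mul_right h.2 p⟩

theorem shift_mono (p : P) : Monotone (shift (α := α) p) := by
  refine StrictMono.monotone fun n n' h => ?_
  obtain ⟨x, hx, hlt⟩ := Finsupp.Lex.lt_iff.1 h
  have hinv (y : α ×ₗ P) : translate α p⁻¹ (translate α p y) = y := by
    rw [← translate_symm, Equiv.symm_apply_apply]
  refine Finsupp.Lex.lt_iff.2 ⟨translate α p x, fun y hy => ?_, ?_⟩
  · rw [shift_apply, shift_apply]
    exact hx _ (hinv x ▸ translate_lt_translate p⁻¹ hy)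
  · rw [shift_apply, shift_apply, hinv]
    exact hlt

instance : MulLeftMono (MagnusGroup α P) where
  elim c a b h := by
    change a ≤ b at h
    change c * a ≤ c * b
    rw [le_def] at h ⊢
    refine h.imp (fun h => mul_lt_mul_right h _) fun h => ⟨congrArg (c.right * ·) h.1, ?_⟩
    exact add_le_add_right (shift_mono _ h.2) _

instance [MulRightMono P] : MulRightMono (MagnusGroup α P) where
  elim c a b h := by
    change a ≤ b at h
    change a * c ≤ b * c
    rw [le_def] at h ⊢
    refine h.imp (fun h => mul_lt_mul_left h _) fun h => ⟨congrArg (· * _) h.1, ?_⟩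
    change a.left + shift a.right c.left ≤ b.left + shift b.right c.left
    rw [h.1]
    exact add_le_add_left h.2 _

end Order

end MagnusGroup

section Magnus

variable {α P : Type*} [Group P] (φ : FreeGroup α →* P)

/-- The Magnus embedding of `F / [ker φ, ker φ]`, as a hom from the free group `F`. -/
noncomputable def magnusHom : FreeGroup α →* MagnusGroup α P :=
  FreeGroup.lift fun l => ⟨toLex (Finsupp.single (toLex (l, 1)) 1), φ (FreeGroup.of l)⟩

theorem magnusHom_right (w : FreeGroup α) : (magnusHom φ w).right = φ w := by
  have : ({ toFun := MagnusGroup.right, map_one' := rfl, map_mul' := fun _ _ => rfl } :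
      MagnusGroup α P →* P).comp (magnusHom φ) = φ := by
    ext l
    simp [magnusHom]
  exact DFunLike.congr_fun this w

variable [DecidableEq α] [DecidableEq P]

theorem coeffHom_comp_magnusHom (k : α) : (MagnusGroup.coeffHom k).comp (magnusHom φ) =
    labelHom φ k (Pi.mulSingle 1 (Multiplicative.ofAdd (1 : ℤ))) := by
  ext l x
  · simp only [magnusHom, labelHom, MonoidHom.comp_apply, FreeGroup.lift_apply_of,
      MagnusGroup.coeffHom_left, ofLex_toLex, Finsupp.single_apply, toLex_inj, Prod.mk.injEq]
    by_cases hl : l = k <;> by_cases hx : x = 1 <;> simp [hl, hx, eq_comm]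
  · simp [magnusHom]

theorem magnusHom_left_apply (w : FreeGroup α) (k : α) (x : P) :
    ofLex (magnusHom φ w).left (toLex (k, x)) = edgeCount φ k w x := by
  have := DFunLike.congr_fun (coeffHom_comp_magnusHom φ k) w
  exact congrArg (fun g => (g.left x).toAdd) this

theorem magnusHom_eq_one_iff {w : FreeGroup α} :
    magnusHom φ w = 1 ↔ φ w = 1 ∧ ∀ k x, edgeCount φ k w x = 0 := by
  simp_rw [← magnusHom_left_apply, ← magnusHom_right φ w]
  constructor
  · intro h
    rw [h]
    exact ⟨rfl, fun _ _ => rfl⟩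
  · rintro ⟨hr, hl⟩
    ext1
    · exact ofLex.injective (Finsupp.ext fun x => hl (ofLex x).1 (ofLex x).2)
    · exact hr

end Magnus

section Crossing

variable {α P : Type*} [Group P] [DecidableEq α] [DecidableEq P] (φ : FreeGroup α →* P) (k : α)

theorem edgeCount_cons_true (l : α) (L : List (α × Bool)) (x : P) :
    edgeCount φ k (FreeGroup.mk ((l, true) :: L)) x =
      (if l = k ∧ x = 1 then 1 else 0) +
        edgeCount φ k (FreeGroup.mk L) ((φ (FreeGroup.of l))⁻¹ * x) := by
  rw [edgeCount, labelHom_cons_true_left, toAdd_mul]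
  congr 1
  by_cases hl : l = k <;> by_cases hx : x = 1 <;> simp [hl, hx]

theorem edgeCount_cons_false (l : α) (L : List (α × Bool)) (x : P) :
    edgeCount φ k (FreeGroup.mk ((l, false) :: L)) x =
      -(if l = k ∧ φ (FreeGroup.of l) * x = 1 then 1 else 0) +
        edgeCount φ k (FreeGroup.mk L) (φ (FreeGroup.of l) * x) := by
  rw [edgeCount, labelHom_cons_false_left, toAdd_mul]
  congr 1
  by_cases hl : l = k
  · subst hl
    by_cases hx : φ (FreeGroup.of l) * x = 1 <;> simp [hx]
  · simp [hl]

/-- A nonzero count is witnessed by a letter of the word traversing the `k`-edge at `1`. -/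
theorem exists_crossing_of_edgeCount_ne_zero {L : List (α × Bool)} {x : P}
    (h : edgeCount φ k (FreeGroup.mk L) x ≠ 0) :
    ∃ L₁ ε L₂, L = L₁ ++ (k, ε) :: L₂ ∧
      x = φ (FreeGroup.mk L₁ * if ε then 1 else (FreeGroup.of k)⁻¹) := by
  induction L generalizing x with
  | nil => exact absurd (by simp [edgeCount, ← FreeGroup.one_eq_mk]) h
  | cons a L ih =>
    obtain ⟨l, _ | _⟩ := a
    · rw [edgeCount_cons_false] at h
      by_cases hlx : l = k ∧ φ (FreeGroup.of l) * x = 1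
      · obtain ⟨rfl, hx⟩ := hlx
        refine ⟨[], false, L, rfl, ?_⟩
        simpa [← FreeGroup.one_eq_mk, map_inv φ] using eq_inv_of_mul_eq_one_right hx
      · rw [if_neg hlx, neg_zero, zero_add] at h
        obtain ⟨L₁, ε, L₂, rfl, hx⟩ := ih h
        refine ⟨(l, false) :: L₁, ε, L₂, rfl, ?_⟩
        rw [show FreeGroup.mk ((l, false) :: L₁) = (FreeGroup.of l)⁻¹ * FreeGroup.mk L₁ from rfl,
          mul_assoc, map_mul φ, ← hx, map_inv φ, inv_mul_cancel_left]
    · rw [edgeCount_cons_true] at h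
      by_cases hlx : l = k ∧ x = 1
      · obtain ⟨rfl, rfl⟩ := hlx
        exact ⟨[], true, L, rfl, by simp [← FreeGroup.one_eq_mk]⟩
      · rw [if_neg hlx, zero_add] at h
        obtain ⟨L₁, ε, L₂, rfl, hx⟩ := ih h
        refine ⟨(l, true) :: L₁, ε, L₂, rfl, ?_⟩
        rw [show FreeGroup.mk ((l, true) :: L₁) = FreeGroup.of l * FreeGroup.mk L₁ from rfl,
          mul_assoc, map_mul φ, ← hx, mul_inv_cancel_left]

/-- If `φ` kills no nonempty reduced word of length at most `N`, then a nonempty reduced word of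
length at most `N + 1` traverses its first edge only once. -/
theorem exists_edgeCount_ne_zero {N : ℕ} (hφ : ∀ L : List (α × Bool), FreeGroup.IsReduced L →
    L ≠ [] → L.length ≤ N → φ (FreeGroup.mk L) ≠ 1) {L : List (α × Bool)}
    (hL : FreeGroup.IsReduced L) (hne : L ≠ []) (hN : L.length ≤ N + 1) :
    ∃ k x, edgeCount φ k (FreeGroup.mk L) x ≠ 0 := by
  obtain ⟨⟨k, ε⟩, L, rfl⟩ := List.exists_cons_of_ne_nil hne
  have key : edgeCount φ k (FreeGroup.mk L)
      (φ (if ε then (FreeGroup.of k)⁻¹ else 1)) = 0 := by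
    by_contra h
    obtain ⟨L₁, ε', L₂, rfl, hx⟩ := exists_crossing_of_edgeCount_ne_zero φ k h
    simp only [List.length_cons, List.length_append] at hN
    have hsame : ε = ε' → φ (FreeGroup.mk ((k, ε) :: L₁)) = 1 := by
      rintro rfl
      cases ε
      · rw [show FreeGroup.mk ((k, false) :: L₁) = (FreeGroup.of k)⁻¹ * FreeGroup.mk L₁ from rfl]
        simp only [Bool.false_eq_true, if_false, map_one, map_mul, map_inv] at hx ⊢
        rw [inv_mul_eq_one, ← mul_inv_eq_one.1 hx.symm]
      · rw [show FreeGroup.mk ((k, true) :: L₁) = FreeGroup.of k * FreeGroup.mk L₁ from rfl]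
        simp only [if_true, map_mul, map_inv, mul_one] at hx ⊢
        rw [← hx, mul_inv_cancel]
    have hdiff : ε ≠ ε' → φ (FreeGroup.mk L₁) = 1 := by
      intro hε
      cases ε <;> cases ε' <;> simp_all
    by_cases hε : ε = ε'
    · exact hφ _ (hL.infix ⟨[], (k, ε') :: L₂, by simp⟩) (List.cons_ne_nil _ _)
        (by simp only [List.length_cons]; omega) (hsame hε)
    · refine hφ L₁ (hL.infix ⟨[(k, ε)], (k, ε') :: L₂, by simp⟩) ?_ (by omega) (hdiff hε)
      rintro rfl
      exact hε ((List.isChain_cons_cons.1 hL).1 rfl)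
  cases ε
  · refine ⟨k, (φ (FreeGroup.of k))⁻¹, ?_⟩
    rw [edgeCount_cons_false]
    simp_all
  · refine ⟨k, 1, ?_⟩
    rw [edgeCount_cons_true]
    simp_all

end Crossing

/-- Every nontrivial element of a free group dies in some bi-ordered quotient but survives in
the next term of the corresponding Magnus tower. -/
theorem exists_hom_eq_one_magnusHom_ne_one {α : Type u} [LinearOrder α] {w : FreeGroup α}
    (hw : w ≠ 1) : ∃ (P : Type u) (_ : Group P) (_ : LinearOrder P) (_ : MulLeftMono P)
      (_ : MulRightMono P) (φ : FreeGroup α →* P), φ w = 1 ∧ magnusHom φ w ≠ 1 := by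
  by_contra! h
  have hgood (N : ℕ) : ∃ (P : Type u) (_ : Group P) (_ : LinearOrder P) (_ : MulLeftMono P)
      (_ : MulRightMono P) (φ : FreeGroup α →* P), φ w = 1 ∧ ∀ L : List (α × Bool),
        FreeGroup.IsReduced L → L ≠ [] → L.length ≤ N → φ (FreeGroup.mk L) ≠ 1 := by
    induction N with
    | zero =>
      exact ⟨PUnit, inferInstance, inferInstance, ⟨fun _ _ _ _ => le_rfl⟩,
        ⟨fun _ _ _ _ => le_rfl⟩, 1, rfl, fun L _ hne hL =>
        absurd (List.length_eq_zero_iff.1 (Nat.le_zero.1 hL)) hne⟩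
    | succ N ih =>
      obtain ⟨P, _, _, _, _, φ, hφw, hφ⟩ := ih
      refine ⟨MagnusGroup α P, inferInstance, inferInstance, inferInstance, inferInstance,
        magnusHom φ, h P _ _ ‹_› ‹_› φ hφw, fun L hL hne hN h1 => ?_⟩
      obtain ⟨k, x, hx⟩ := exists_edgeCount_ne_zero φ hφ hL hne hN
      exact hx (((magnusHom_eq_one_iff φ).1 h1).2 k x)
  obtain ⟨P, _, _, _, _, φ, hφw, hφ⟩ := hgood w.toWord.length
  refine hφ w.toWord FreeGroup.isReduced_toWord (mt FreeGroup.toWord_eq_nil_iff.1 hw) le_rfl ?_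
  rwa [FreeGroup.mk_toWord]

/-- Every nonabelian subgroup of a free group contains a universally solvable pair. -/
theorem exists_universallySolvable_pair {α : Type u} {D : Subgroup (FreeGroup α)}
    (hna : ∃ x y : D, x * y ≠ y * x) :
    ∃ w : Bool → FreeGroup α, (∀ i, w i ∈ D) ∧ UniversallySolvable.{u} w := by
  classical
  obtain ⟨_, -⟩ := exists_wellFoundedLT α
  obtain ⟨⟨x, hx⟩, ⟨y, hy⟩, hxy⟩ := hna
  have hw : ⁅x, y⁆ ≠ 1 := fun h => hxy (Subtype.ext (commutatorElement_eq_one_iff_mul_comm.1 h))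
  obtain ⟨P, _, _, _, _, φ, hφw, hφw'⟩ := exists_hom_eq_one_magnusHom_ne_one hw
  have hcount : ∃ k p, edgeCount φ k ⁅x, y⁆ p ≠ 0 := by
    by_contra! h
    exact hφw' ((magnusHom_eq_one_iff φ).2 ⟨hφw, h⟩)
  obtain ⟨k, hk⟩ := hcount
  have hd : ∃ d ∈ D, φ d ≠ 1 := by
    by_contra! h
    refine hφw' ?_
    rw [map_commutatorElement, commutatorElement_eq_one_iff_commute]
    exact MagnusGroup.commute_of_right_eq_one (by rw [magnusHom_right, h x hx])
      (by rw [magnusHom_right, h y hy])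
  have hd' : ∃ d ∈ D, 1 < φ d := by
    obtain ⟨d, hdD, hd⟩ := hd
    rcases hd.lt_or_gt with hd | hd
    · exact ⟨d⁻¹, D.inv_mem hdD, by rwa [map_inv, one_lt_inv']⟩
    · exact ⟨d, hdD, hd⟩
  obtain ⟨d, hdD, hd⟩ := hd'
  obtain ⟨m, hm⟩ := exists_universallySolvable_commutators φ k hφw hd hk
  have hcomm {v v' : FreeGroup α} (hv : v ∈ D) (hv' : v' ∈ D) : ⁅v, v'⁆ ∈ D :=
    D.mul_mem (D.mul_mem (D.mul_mem hv hv') (D.inv_mem hv)) (D.inv_mem hv')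
  exact ⟨_, fun i => hcomm (hcomm hx hy)
    (D.mul_mem (D.mul_mem (D.pow_mem hdD _) (hcomm hx hy)) (D.inv_mem (D.pow_mem hdD _))), hm⟩

/-- Olshanskii's theorem, in the special case of a free ambient group: if `F` is a
finitely generated free group, `D ≤ F` is non-abelian and `n ≥ 2` is finite, then
there is a subgroup `H ≤ D` which is free of rank `n` and CEP in `F`. -/
theorem stmt_13 {α : Type*} [Finite α] (D : Subgroup (FreeGroup α))
    (hna : ∃ x y : D, x * y ≠ y * x) (n : ℕ) (hn : 2 ≤ n) :
    ∃ H : Subgroup (FreeGroup α), H ≤ D ∧ IsCEP H ∧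
      Nonempty (H ≃* FreeGroup (Fin n)) := by
  obtain ⟨w, hwD, hw⟩ := exists_universallySolvable_pair hna
  have hW := hw.commutator_conj n
  refine ⟨_, ?_, hW.isCEP_range_lift, ⟨(MonoidHom.ofInjective hW.lift_injective).symm⟩⟩
  rw [FreeGroup.range_lift_eq_closure, Subgroup.closure_le]
  rintro _ ⟨i, rfl⟩
  have hv := D.mul_mem (D.mul_mem (D.pow_mem (hwD false) (2 * i.val + 1)) (hwD true))
    (D.inv_mem (D.pow_mem (hwD false) (2 * i.val + 1)))
  exact D.mul_mem (D.mul_mem (D.mul_mem (hwD true) hv) (D.inv_mem (hwD true))) (D.inv_mem hv)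
end

section
/- Let G be a group, H ≤ G a subgroup, and S ⊆ H ∖ {1} a finite subset such that for every R ⊆ H with ⟪R⟫_H ∩ S = ∅ one has ⟪R⟫_H = H ∩ ⟪R⟫_G (i.e., S witnesses that H ≤ G is almost-CEP). Let M ≤ H be a subgroup such that the extension M ≤ H satisfies CEP and such that the normal closure ⟪M⟫_H of M in H is disjoint from S. Then the extension M ≤ G satisfies CEP. -/
/-- Let `H ≤ G` and let `S ⊆ H ∖ {1}` be a finite set witnessing that `H ≤ G` is
almost-CEP. If `M ≤ H` is CEP in `H` and the normal closure of `M` in `H` is disjoint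
from `S`, then `M ≤ G` is CEP. -/
theorem stmt_14 {G : Type*} [Group G] (H : Subgroup G) (S : Set H)
    (hSfin : S.Finite) (hS1 : (1 : H) ∉ S)
    (hACEP : ∀ R : Set H, (Subgroup.normalClosure R : Set H) ∩ S = ∅ →
      Subgroup.normalClosure R =
        (Subgroup.normalClosure (Subtype.val '' R)).comap H.subtype)
    (M : Subgroup H) (hMCEP : IsCEP M)
    (hMS : (Subgroup.normalClosure (M : Set H) : Set H) ∩ S = ∅) :
    IsCEP (M.map H.subtype) := by
  intro R
  have hval : ∀ m : M, (m : H).val ∈ M.map H.subtype :=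
    fun m => Subgroup.mem_map_of_mem H.subtype m.2
  let e : M →* M.map H.subtype := (H.subtype.comp M.subtype).codRestrict _ hval
  apply le_antisymm
  · exact Subgroup.normalClosure_le_normal fun r hr =>
      Subgroup.subset_normalClosure ⟨r, hr, rfl⟩
  rintro ⟨_, h, hm, rfl⟩ hx
  have hdisj : (Subgroup.normalClosure (Subtype.val '' (e ⁻¹' R)) : Set H) ∩ S = ∅ := by
    refine Set.subset_empty_iff.mp (hMS ▸ Set.inter_subset_inter_left S ?_)
    apply Subgroup.normalClosure_mono
    rintro _ ⟨m, -, rfl⟩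
    exact m.2
  have himage : Subtype.val '' R ⊆ (Subtype.val '' (Subtype.val '' (e ⁻¹' R) : Set H) : Set G) := by
    rintro _ ⟨⟨_, k, hk, rfl⟩, hr, rfl⟩
    exact ⟨k, ⟨⟨k, hk⟩, hr, rfl⟩, rfl⟩
  have hH : h ∈ Subgroup.normalClosure (Subtype.val '' (e ⁻¹' R)) := by
    rw [hACEP _ hdisj]
    exact Subgroup.normalClosure_mono himage hx
  have hM : (⟨h, hm⟩ : M) ∈ Subgroup.normalClosure (e ⁻¹' R) := by
    rw [hMCEP]
    exact hH
  have hle : Subgroup.normalClosure (e ⁻¹' R) ≤ (Subgroup.normalClosure R).comap e :=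
    Subgroup.normalClosure_le_normal fun m hr => Subgroup.subset_normalClosure hr
  exact hle hM
end
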